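/- If A is a tame central essential arrangement, then the logarithmic ideal I(A) is prime, and equals the vanishing ideal of the Zariski closure of Σ(A) in V × C^n. -/

import Mathlib

open MvPolynomial Finset

/-- The `i`-th defining linear form, in `S = ℂ[a_1,…,a_n,x_1,…,x_ℓ]`
(variables `Sum.inl i = a_i`, `Sum.inr j = x_j`). -/
noncomputable def fS {ℓ n : ℕ} (c : Fin n → Fin ℓ → ℂ) (i : Fin n) :
    MvPolynomial (Fin n ⊕ Fin ℓ) ℂ :=
  ∑ j, C (c i j) * X (Sum.inr j)

/-- The defining polynomial `Q = f_1 ⋯ f_n` of the arrangement, in `S`. -/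
noncomputable def QS {ℓ n : ℕ} (c : Fin n → Fin ℓ → ℂ) : MvPolynomial (Fin n ⊕ Fin ℓ) ℂ :=
  ∏ i, fS c i

/-- `Q/f_i`. -/
noncomputable def Qdiv {ℓ n : ℕ} (c : Fin n → Fin ℓ → ℂ) (i : Fin n) :
    MvPolynomial (Fin n ⊕ Fin ℓ) ℂ :=
  ∏ k ∈ univ.erase i, fS c k

/-- `Q·d_j = ∑_i a_i c_{ij} Q/f_i`, the numerator of the `j`-th coordinate of the
universal 1-form `ω_a = ∑_i a_i df_i/f_i`. -/
noncomputable def Qd {ℓ n : ℕ} (c : Fin n → Fin ℓ → ℂ) (j : Fin ℓ) :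
    MvPolynomial (Fin n ⊕ Fin ℓ) ℂ :=
  ∑ i, X (Sum.inl i) * C (c i j) * Qdiv c i

/-- `θ = ∑_j θ_j ∂/∂x_j` (coefficients in `S`) is a logarithmic derivation: `θ(Q) ∈ (Q)`. -/
def IsLogDer {ℓ n : ℕ} (c : Fin n → Fin ℓ → ℂ)
    (θ : Fin ℓ → MvPolynomial (Fin n ⊕ Fin ℓ) ℂ) : Prop :=
  (∑ j, θ j * pderiv (Sum.inr j) (QS c)) ∈ Ideal.span {QS c}

/-- `g = ⟨θ, ω_a⟩`, i.e. `Q·g = ∑_i a_i (Q/f_i) θ(f_i)`. -/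
def PairsWith {ℓ n : ℕ} (c : Fin n → Fin ℓ → ℂ)
    (θ : Fin ℓ → MvPolynomial (Fin n ⊕ Fin ℓ) ℂ)
    (g : MvPolynomial (Fin n ⊕ Fin ℓ) ℂ) : Prop :=
  QS c * g = ∑ i, X (Sum.inl i) * Qdiv c i * (∑ j, θ j * pderiv (Sum.inr j) (fS c i))

/-- The logarithmic ideal `I(A) = (⟨θ, ω_a⟩ : θ ∈ Der(A))  ⊆ S`. -/
noncomputable def Ilog {ℓ n : ℕ} (c : Fin n → Fin ℓ → ℂ) :
    Ideal (MvPolynomial (Fin n ⊕ Fin ℓ) ℂ) :=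
  Ideal.span {g | ∃ θ, IsLogDer c θ ∧ PairsWith c θ g}

/-- The grading of `S` by degree in the `x`-variables. -/
noncomputable def xwt {ℓ n : ℕ} : (Fin n ⊕ Fin ℓ) → ℕ :=
  Sum.elim (fun _ => 0) (fun _ => 1)

/-- Wedge (interior coefficient formula) of a 1-form with coordinates `v` against a form
given by its coefficient function `μ` on index sets: `(v ∧ μ)_T = ∑_{j∈T} ± v_j μ_{T∖j}`. -/
noncomputable def wedge1 {ℓ : ℕ} {A : Type*} [CommRing A] (v : Fin ℓ → A)
    (μ : Finset (Fin ℓ) → A) (T : Finset (Fin ℓ)) : A :=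
  ∑ j ∈ T, (-1 : A) ^ ((T.filter (· < j)).card) * v j * μ (T.erase j)

lemma wedge1_add {ℓ : ℕ} {A : Type*} [CommRing A] (v : Fin ℓ → A) (a b : Finset (Fin ℓ) → A)
    (T : Finset (Fin ℓ)) : wedge1 v (a + b) T = wedge1 v a T + wedge1 v b T := by
  simp [wedge1, mul_add, Finset.sum_add_distrib]

lemma wedge1_smul {ℓ : ℕ} {A : Type*} [CommRing A] (v : Fin ℓ → A) (r : A)
    (a : Finset (Fin ℓ) → A) (T : Finset (Fin ℓ)) : wedge1 v (r • a) T = r * wedge1 v a T := by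
  simp only [wedge1, Pi.smul_apply, smul_eq_mul, Finset.mul_sum]
  exact Finset.sum_congr rfl (fun j _ => by ring)

/-- Wedge product of a `p`-form `μ` with a form `ν` (coefficient functions on index sets):
`(μ ∧ ν)_T = ∑_{B ⊆ T, |B| = p} ± μ_B ν_{T∖B}`, with the shuffle sign. -/
noncomputable def wedgeP {ℓ : ℕ} {A : Type*} [CommRing A] (p : ℕ)
    (μ ν : Finset (Fin ℓ) → A) (T : Finset (Fin ℓ)) : A :=
  ∑ B ∈ T.powersetCard p,
    (-1 : A) ^ (∑ b ∈ B, ((T \ B).filter (· < b)).card) * μ B * ν (T \ B)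

/-- The module of (numerators of) logarithmic `p`-forms of the arrangement with defining
polynomial `Q`: a form `η ∈ Ω^p(A)` is written `η = μ/Q` with `μ` a polynomial `p`-form,
and the condition `Q·dη` regular is equivalent to `Q ∣ (dQ ∧ μ)` coefficientwise.
(The grading: `η` has total degree `m` iff each `μ_T` is homogeneous of degree `m+n-p`.) -/
noncomputable def logForms (ℓ : ℕ) (Q : MvPolynomial (Fin ℓ) ℂ) (p : ℕ) :
    Submodule (MvPolynomial (Fin ℓ) ℂ) (Finset (Fin ℓ) → MvPolynomial (Fin ℓ) ℂ) where
  carrier := {μ | (∀ T, T.card ≠ p → μ T = 0) ∧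
    ∀ T, Q ∣ wedge1 (fun j => pderiv j Q) μ T}
  add_mem' := by
    rintro a b ⟨ha1, ha2⟩ ⟨hb1, hb2⟩
    refine ⟨fun T hT => by simp [Pi.add_apply, ha1 T hT, hb1 T hT], fun T => ?_⟩
    rw [wedge1_add]
    exact dvd_add (ha2 T) (hb2 T)
  zero_mem' := ⟨fun _ _ => rfl, fun T => by simp [wedge1]⟩
  smul_mem' := by
    rintro r a ⟨ha1, ha2⟩
    refine ⟨fun T hT => by simp [ha1 T hT], fun T => ?_⟩
    rw [wedge1_smul]
    exact Dvd.dvd.mul_left (ha2 T) r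

/-- The defining polynomial in `R = ℂ[x_1,…,x_ℓ]`. -/
noncomputable def Qx {ℓ n : ℕ} (c : Fin n → Fin ℓ → ℂ) : MvPolynomial (Fin ℓ) ℂ :=
  ∏ i, ∑ j, C (c i j) * X j

/-- Projective dimension at most `m` over `R`. -/
def pdLE (R : Type) [CommRing R] : ℕ → (M : Type) → [AddCommGroup M] → [Module R M] → Prop
  | 0, M, _, _ => Module.Projective R M
  | m + 1, M, _, _ => ∃ (k : ℕ) (φ : (Fin k → R) →ₗ[R] M),
      Function.Surjective φ ∧ pdLE R m (LinearMap.ker φ)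

/-- Tameness: `pd_R Ω^p(A) ≤ p` for all `0 ≤ p ≤ ℓ`. -/
def ArrTame {ℓ n : ℕ} (c : Fin n → Fin ℓ → ℂ) : Prop :=
  ∀ p ≤ ℓ, pdLE (MvPolynomial (Fin ℓ) ℂ) p (logForms ℓ (Qx c) p)

/-- Vanishing of low-degree Ext. -/
def VExt (S : Type) [CommRing S] (N : Type) [AddCommGroup N] [Module S N]
    (M : Type) [AddCommGroup M] [Module S M] (k : ℕ) : Prop :=
  ∀ i < k, Subsingleton (CategoryTheory.Abelian.Ext (ModuleCat.of S N) (ModuleCat.of S M) i)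

section vext
open CategoryTheory CategoryTheory.Abelian

variable {S : Type} [CommRing S] {N : Type} [AddCommGroup N] [Module S N]

lemma VExt.mono {M : Type} [AddCommGroup M] [Module S M] {k k' : ℕ} (h : VExt S N M k)
    (hk : k' ≤ k) : VExt S N M k' := fun i hi => h i (lt_of_lt_of_le hi hk)

lemma vext_ses {A B D : Type} [AddCommGroup A] [Module S A] [AddCommGroup B] [Module S B]
    [AddCommGroup D] [Module S D] (f : A →ₗ[S] B) (g : B →ₗ[S] D)
    (hf : Function.Injective f) (hg : Function.Surjective g) (hfg : Function.Exact f g)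
    {k : ℕ} (hA : VExt S N A (k+1)) (hB : VExt S N B k) : VExt S N D k := by
  let C : ShortComplex (ModuleCat.{0} S) :=
    ShortComplex.mk (ModuleCat.ofHom f) (ModuleCat.ofHom g) (by
      ext x; exact hfg.apply_apply_eq_zero x)
  have hC : C.ShortExact := by
    refine ShortComplex.ShortExact.mk' ?_ ?_ ?_
    · rw [ShortComplex.ShortExact.moduleCat_exact_iff_function_exact]
      exact hfg
    · exact (ModuleCat.mono_iff_injective _).2 hf
    · exact (ModuleCat.epi_iff_surjective _).2 hg
  intro i hi
  refine ⟨fun a b => ?_⟩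
  have key : ∀ x : Ext (ModuleCat.of S N) C.X₃ i, x = 0 := by
    intro x
    have h1 : Subsingleton (Ext (ModuleCat.of S N) C.X₁ (i+1)) := hA (i+1) (by omega)
    have h2 : Subsingleton (Ext (ModuleCat.of S N) C.X₂ i) := hB i hi
    obtain ⟨y, hy⟩ := Ext.covariant_sequence_exact₃ (ModuleCat.of S N) hC x rfl
      (Subsingleton.eq_zero _)
    rw [← hy, Subsingleton.eq_zero y, Ext.zero_comp]
  exact (key a).trans (key b).symm

lemma vext_equiv {A B : Type} [AddCommGroup A] [Module S A] [AddCommGroup B] [Module S B]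
    (e : A ≃ₗ[S] B) {k : ℕ} (hA : VExt S N A k) : VExt S N B k := by
  intro i hi
  have h1 := hA i hi
  refine ⟨fun a b => ?_⟩
  have key : ∀ x : Ext (ModuleCat.of S N) (ModuleCat.of S B) i, x = 0 := by
    intro x
    have hx : (x.comp (Ext.mk₀ (ModuleCat.ofHom e.symm.toLinearMap)) (add_zero i)).comp
        (Ext.mk₀ (ModuleCat.ofHom e.toLinearMap)) (add_zero i) = x := by
      rw [Ext.comp_assoc_of_second_deg_zero, Ext.mk₀_comp_mk₀]
      have : ModuleCat.ofHom e.symm.toLinearMap ≫ ModuleCat.ofHom e.toLinearMap = 𝟙 _ := by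
        ext y; simp
      rw [this, Ext.comp_mk₀_id]
    rw [← hx, Subsingleton.eq_zero (x.comp (Ext.mk₀ (ModuleCat.ofHom e.symm.toLinearMap)) (add_zero i)), Ext.zero_comp]
  exact (key a).trans (key b).symm

lemma vext_regular (rs : List S) : ∀ (M : Type) [AddCommGroup M] [Module S M],
    RingTheory.Sequence.IsWeaklyRegular M rs → (∀ r ∈ rs, ∀ x : N, r • x = 0) →
    VExt S N M rs.length := by
  induction rs with
  | nil => intro M _ _ _ _ i hi; simp at hi
  | cons r rs ih =>
    intro M _ _ hreg hN
    rw [RingTheory.Sequence.isWeaklyRegular_cons_iff] at hreg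
    have h1 := ih (QuotSMulTop r M) hreg.2 (fun r' hr' => hN r' (List.mem_cons_of_mem _ hr'))
    intro i
    have hC := IsSMulRegular.smulShortComplex_shortExact (M := ModuleCat.of S M) hreg.1
    have hzero : ∀ (i : ℕ) (x : Ext (ModuleCat.of S N) (ModuleCat.of S M) i), r • x = 0 := by
      intro i x
      have : (Ext.mk₀ (r • 𝟙 (ModuleCat.of S N))).comp x (zero_add i) = r • x := by
        rw [Ext.mk₀_smul, Ext.smul_comp, Ext.mk₀_id_comp]
      rw [← this]
      have h0 : (r • 𝟙 (ModuleCat.of S N)) = 0 := by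
        ext y; exact hN r List.mem_cons_self y
      rw [h0, Ext.mk₀_zero, Ext.zero_comp]
    intro hi
    refine ⟨fun a b => ?_⟩
    have key : ∀ x : Ext (ModuleCat.of S N) (ModuleCat.of S M) i, x = 0 := by
      intro x
      have hx : x.comp (Ext.mk₀ ((ModuleCat.of S M).smulShortComplex r).f) (add_zero i) = 0 := by
        have e1 : x.comp (Ext.mk₀ (r • 𝟙 (ModuleCat.of S M))) (add_zero i) = 0 := by
          rw [Ext.mk₀_smul, Ext.comp_smul, Ext.comp_mk₀_id]
          exact hzero i x
        exact e1
      cases i with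
      | zero =>
        have hm := hC.mono_f
        apply Ext.postcomp_mk₀_injective_of_mono (ModuleCat.of S N)
          ((ModuleCat.of S M).smulShortComplex r).f
        exact hx.trans (map_zero ((Ext.mk₀ ((ModuleCat.of S M).smulShortComplex r).f).postcomp
          (ModuleCat.of S N) (add_zero 0))).symm
      | succ j =>
        obtain ⟨y, hy⟩ := Ext.covariant_sequence_exact₁ (ModuleCat.of S N) hC x hx rfl
        have : Subsingleton (Ext (ModuleCat.of S N) ((ModuleCat.of S M).smulShortComplex r).X₃ j) :=
          h1 j (by simpa using hi)
        rw [← hy, Subsingleton.eq_zero y, Ext.zero_comp]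
        rfl
    exact (key a).trans (key b).symm

lemma vext_flat (rs : List S) (M : Type) [AddCommGroup M] [Module S M] [Module.Flat S M]
    (h : RingTheory.Sequence.IsWeaklyRegular S rs) (hN : ∀ r ∈ rs, ∀ x : N, r • x = 0) :
    VExt S N M rs.length := by
  refine vext_regular rs M ?_ hN
  have := h.isWeaklyRegular_lTensor (M₂ := M)
  exact (LinearEquiv.isWeaklyRegular_congr (TensorProduct.rid S M) rs).1 this

lemma vext_ass {M : Type} [AddCommGroup M] [Module S M] {P : Ideal S} [IsNoetherianRing S]
    (hP : IsAssociatedPrime P M) (h : VExt S (S ⧸ P) M 1) : False := by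
  obtain ⟨hp, x, hx⟩ := isAssociatedPrime_iff.1 hP
  have h0 := h 0 (by norm_num)
  have h1 : Subsingleton (ModuleCat.of S (S ⧸ P) ⟶ ModuleCat.of S M) :=
    Ext.homEquiv₀.subsingleton_congr.mp h0
  have hle : P ≤ LinearMap.ker (LinearMap.toSpanSingleton S M x) := by
    intro s hs
    rw [hx, Submodule.mem_colon_singleton] at hs
    simpa using hs
  let φ : (S ⧸ P) →ₗ[S] M := Submodule.liftQ P (LinearMap.toSpanSingleton S M x) hle
  have h2 : ModuleCat.ofHom φ = ModuleCat.ofHom (0 : (S ⧸ P) →ₗ[S] M) := Subsingleton.elim _ _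
  have h3 : φ = 0 := by simpa using congrArg ModuleCat.Hom.hom h2
  have h4 : φ (Submodule.Quotient.mk 1) = 0 := by rw [h3]; rfl
  have h5 : x = 0 := by
    have h6 : φ (Submodule.Quotient.mk 1) = (1 : S) • x := Submodule.liftQ_apply _ _ _
    rw [← one_smul S x, ← h6, h4]
  apply hp.ne_top
  rw [hx, h5]
  ext s
  simp [Submodule.mem_colon_singleton]

end vext

/-- transfer of projective dimension to Ext vanishing after flat base change -/
lemma vext_pd {R S : Type} [CommRing R] [CommRing S] [Algebra R S] [Module.Flat R S]
    {N : Type} [AddCommGroup N] [Module S N] (rs : List S)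
    (hreg : RingTheory.Sequence.IsWeaklyRegular S rs) (hN : ∀ r ∈ rs, ∀ x : N, r • x = 0)
    (p : ℕ) : ∀ (M : Type) [AddCommGroup M] [Module R M] (k : ℕ), k + p ≤ rs.length →
      pdLE R p M → VExt S N (TensorProduct R S M) k := by
  induction p with
  | zero =>
    intro M _ _ k hk hM
    have : Module.Projective R M := hM
    exact (vext_flat rs _ hreg hN).mono (by simpa using hk)
  | succ p ih =>
    rintro M _ _ k hk ⟨m, φ, hφ, hK⟩
    have h1 := ih (LinearMap.ker φ) (k+1) (by omega) hK
    have h2 : VExt S N (TensorProduct R S (Fin m → R)) k :=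
      (vext_flat rs _ hreg hN).mono (by omega)
    refine vext_ses ((LinearMap.ker φ).subtype.baseChange S) (φ.baseChange S) ?_ ?_ ?_ h1 h2
    · exact Module.Flat.lTensor_preserves_injective_linearMap _ (Submodule.subtype_injective _)
    · exact LinearMap.lTensor_surjective _ hφ
    · exact lTensor_exact S (LinearMap.exact_subtype_ker_map φ) hφ

section nnorm
open Polynomial MvPolynomial Ideal Nat RingHom List

variable {k : Type*} [Field k] {n : ℕ} (f : MvPolynomial (Fin (n + 1)) k)
variable (v w : Fin (n + 1) →₀ ℕ)

namespace NNorm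

section equivT


variable {f v} in
lemma lt_up (vlt : ∀ i, v i < (2 + f.totalDegree)) : ∀ l ∈ ofFn v, l < (2 + f.totalDegree) := by
  grind


/-- We construct an algebra map `T1 f c` which maps `X_i` into `X_i + c • X_0 ^ r_i` when `i ≠ 0`
and `X_0` to `X_0`. -/
noncomputable abbrev T1 (c : k) :
    MvPolynomial (Fin (n + 1)) k →ₐ[k] MvPolynomial (Fin (n + 1)) k :=
  aeval fun i ↦ if i = 0 then X 0 else X i + c • X 0 ^ ((2 + f.totalDegree) ^ (i).1)

lemma t1_comp_t1_neg (c : k) : (T1 f c).comp (T1 f (-c)) = AlgHom.id _ _ := by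
  rw [comp_aeval, ← MvPolynomial.aeval_X_left]
  ext i v
  cases i using Fin.cases <;> simp

/-- `T1 f 1` leads to an algebra equiv `T f`. -/
noncomputable abbrev T := AlgEquiv.ofAlgHom (T1 f 1) (T1 f (-1))
  (t1_comp_t1_neg f 1) (by simpa using t1_comp_t1_neg f (-1))

lemma sum_r_mul_ne (vlt : ∀ i, v i < (2 + f.totalDegree)) (wlt : ∀ i, w i < (2 + f.totalDegree)) (ne : v ≠ w) :
    ∑ x : Fin (n + 1), ((2 + f.totalDegree) ^ (x).1) * v x ≠ ∑ x : Fin (n + 1), ((2 + f.totalDegree) ^ (x).1) * w x := by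
  intro h
  refine ne <| Finsupp.ext <| congrFun <| ofFn_inj.mp ?_
  apply ofDigits_inj_of_len_eq (Nat.lt_add_right f.totalDegree one_lt_two)
    (by simp) (lt_up vlt) (lt_up wlt)
  simpa only [ofDigits_eq_sum_mapIdx, mapIdx_eq_ofFn, get_ofFn, length_ofFn,
    Fin.val_cast, mul_comm, sum_ofFn] using! h

lemma degreeOf_zero_t {a : k} (ha : a ≠ 0) : ((T f) (monomial v a)).degreeOf 0 =
    ∑ i : Fin (n + 1), (((2 + f.totalDegree) ^ (i).1)) * v i := by
  rw [← natDegree_finSuccEquiv, monomial_eq, Finsupp.prod_pow v fun a ↦ X a]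
  simp only [Fin.prod_univ_succ, Fin.sum_univ_succ, map_mul, map_prod, map_pow,
    AlgEquiv.ofAlgHom_apply, MvPolynomial.aeval_C, MvPolynomial.aeval_X, if_pos, Fin.succ_ne_zero,
    ite_false, one_smul, map_add, finSuccEquiv_X_zero, finSuccEquiv_X_succ, algebraMap_eq]
  have h (i : Fin n) :
      (Polynomial.C (X (R := k) i) + Polynomial.X ^ ((2 + f.totalDegree) ^ (i.succ).1)) ^ v i.succ ≠ 0 :=
    pow_ne_zero (v i.succ) (leadingCoeff_ne_zero.mp <| by simp [add_comm, leadingCoeff_X_pow_add_C])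
  rw [natDegree_mul (by simp [ha]) (mul_ne_zero (by simp) (Finset.prod_ne_zero_iff.mpr
    (fun i _ ↦ h i))), natDegree_mul (by simp) (Finset.prod_ne_zero_iff.mpr (fun i _ ↦ h i)),
    natDegree_prod _ _ (fun i _ ↦ h i), natDegree_finSuccEquiv, degreeOf_C]
  simpa only [natDegree_pow, zero_add, natDegree_X, mul_one, Fin.val_zero, pow_zero, one_mul,
    add_right_inj] using Finset.sum_congr rfl (fun i _ ↦ by
    rw [add_comm (Polynomial.C _), natDegree_X_pow_add_C, mul_comm])

/-- `T` maps different monomials of `f` to polynomials with different degrees in `X_0`. -/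
lemma degreeOf_t_ne_of_ne (hv : v ∈ f.support) (hw : w ∈ f.support) (ne : v ≠ w) :
    (T f <| monomial v <| coeff v f).degreeOf 0 ≠
    (T f <| monomial w <| coeff w f).degreeOf 0 := by
  rw [degreeOf_zero_t _ _ <| mem_support_iff.mp hv, degreeOf_zero_t _ _ <| mem_support_iff.mp hw]
  refine sum_r_mul_ne f v w (fun i ↦ ?_) (fun i ↦ ?_) ne <;>
  exact lt_of_le_of_lt ((monomial_le_degreeOf i ‹_›).trans (degreeOf_le_totalDegree f i))
    (by lia)

lemma leadingCoeff_finSuccEquiv_t :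
    (finSuccEquiv k n ((T f) ((monomial v) (coeff v f)))).leadingCoeff =
    algebraMap k _ (coeff v f) := by
  rw [monomial_eq, Finsupp.prod_fintype]
  · simp only [map_mul, map_prod, leadingCoeff_mul, leadingCoeff_prod]
    rw [AlgEquiv.ofAlgHom_apply, algHom_C, algebraMap_eq, finSuccEquiv_apply,
      eval₂Hom_C, coe_comp]
    simp only [AlgEquiv.ofAlgHom_apply, Function.comp_apply, leadingCoeff_C, map_pow,
      leadingCoeff_pow, algebraMap_eq]
    have : ∀ j, ((finSuccEquiv k n) ((T1 f) 1 (X j))).leadingCoeff = 1 := fun j ↦ by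
      by_cases h : j = 0
      · simp [h, finSuccEquiv_apply]
      · simp only [aeval_eq_bind₁, bind₁_X_right, if_neg h, one_smul, map_add, map_pow]
        obtain ⟨i, rfl⟩ := Fin.exists_succ_eq.mpr h
        simp [finSuccEquiv_X_succ, finSuccEquiv_X_zero, add_comm]
    simp only [this, one_pow, Finset.prod_const_one, mul_one]
  exact fun i ↦ pow_zero _

/-- `T` maps `f` into some polynomial in `X_0` such that the leading coefficient is invertible. -/
lemma T_leadingcoeff_isUnit (fne : f ≠ 0) :
    IsUnit (finSuccEquiv k n (T f f)).leadingCoeff := by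
  obtain ⟨v, vin, vs⟩ := Finset.exists_max_image f.support
    (fun v ↦ (T f ((monomial v) (coeff v f))).degreeOf 0) (support_nonempty.mpr fne)
  set h := fun w ↦ (MvPolynomial.monomial w) (coeff w f)
  simp only [← natDegree_finSuccEquiv] at vs
  replace vs : ∀ x ∈ f.support \ {v}, (finSuccEquiv k n ((T f) (h x))).degree <
      (finSuccEquiv k n ((T f) (h v))).degree := by
    intro x hx
    obtain ⟨h1, h2⟩ := Finset.mem_sdiff.mp hx
    apply degree_lt_degree <| lt_of_le_of_ne (vs x h1) ?_
    simpa only [natDegree_finSuccEquiv]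
      using degreeOf_t_ne_of_ne f _ _ h1 vin <| ne_of_not_mem_cons h2
  have coeff : (finSuccEquiv k n ((T f) (h v + ∑ x ∈ f.support \ {v}, h x))).leadingCoeff =
      (finSuccEquiv k n ((T f) (h v))).leadingCoeff := by
    simp only [map_add, map_sum]
    rw [add_comm]
    apply leadingCoeff_add_of_degree_lt <| (lt_of_le_of_lt <| degree_sum_le _ _) ?_
    have h2 : h v ≠ 0 := by simpa [h] using mem_support_iff.mp vin
    replace h2 : (finSuccEquiv k n ((T f) (h v))) ≠ 0 := fun eq ↦ h2 <|
      by simpa only [map_eq_zero_iff _ (AlgEquiv.injective _)] using eq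
    exact (Finset.sup_lt_iff <| Ne.bot_lt (fun x ↦ h2 <| degree_eq_bot.mp x)).mpr vs
  nth_rw 2 [← f.support_sum_monomial_coeff]
  rw [Finset.sum_eq_add_sum_sdiff_singleton_of_mem vin h]
  rw [leadingCoeff_finSuccEquiv_t] at coeff
  simpa only [coeff, algebraMap_eq] using (mem_support_iff.mp vin).isUnit.map MvPolynomial.C

end equivT
end NNorm
end nnorm

lemma isWeaklyRegular_ringEquiv {A B : Type} [CommRing A] [CommRing B] (e : A ≃+* B)
    (rs : List B) (h : RingTheory.Sequence.IsWeaklyRegular B rs) :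
    RingTheory.Sequence.IsWeaklyRegular A (rs.map e.symm) := by
  refine (AddEquiv.isWeaklyRegular_congr (e := e.toAddEquiv) ?_).2 h
  rw [List.forall₂_map_left_iff, List.forall₂_same]
  intro r hr x
  simp

open scoped Pointwise in
lemma reg_seq_poly {A : Type} [CommRing A] [IsDomain A] (f : Polynomial A) (hf : f.Monic)
    (rs : List A) (h : RingTheory.Sequence.IsWeaklyRegular A rs) :
    RingTheory.Sequence.IsWeaklyRegular (Polynomial A) (f :: rs.map Polynomial.C) := by
  refine RingTheory.Sequence.IsWeaklyRegular.cons ?_ ?_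
  · intro a b hab
    exact mul_left_cancel₀ hf.ne_zero hab
  · have heq : f • (⊤ : Submodule (Polynomial A) (Polynomial A)) = Ideal.span {f} := by
      ext x
      rw [Submodule.mem_smul_pointwise_iff_exists, Ideal.mem_span_singleton]
      constructor
      · rintro ⟨b, _, rfl⟩; exact ⟨b, rfl⟩
      · rintro ⟨b, rfl⟩; exact ⟨b, trivial, rfl⟩
    let e0 : QuotSMulTop f (Polynomial A) ≃ₗ[Polynomial A] (Polynomial A ⧸ Ideal.span {f}) :=
      Submodule.quotEquivOfEq _ _ heq
    let e : QuotSMulTop f (Polynomial A) ≃ₗ[A] AdjoinRoot f :=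
      { e0.toAddEquiv with
        map_smul' := by
          intro a x
          induction x using Submodule.Quotient.induction_on with
          | _ x => rfl }
    have hfree : Module.Free A (AdjoinRoot f) := hf.free_adjoinRoot
    have h1 : RingTheory.Sequence.IsWeaklyRegular (AdjoinRoot f) rs :=
      (LinearEquiv.isWeaklyRegular_congr (TensorProduct.rid A (AdjoinRoot f)) rs).1
        (h.isWeaklyRegular_lTensor (M₂ := AdjoinRoot f))
    have h2 := (LinearEquiv.isWeaklyRegular_congr e rs).2 h1
    exact (RingTheory.Sequence.isWeaklyRegular_map_algebraMap_iff (S := Polynomial A) (M := QuotSMulTop f (Polynomial A)) rs).2 h2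

lemma exists_reg_seq_fin (m : ℕ) : ∀ (P : Ideal (MvPolynomial (Fin m) ℂ)) (_ : P.IsPrime) (d : ℕ),
    Algebra.trdeg ℂ (MvPolynomial (Fin m) ℂ ⧸ P) ≤ (d : Cardinal) →
    ∃ rs : List (MvPolynomial (Fin m) ℂ), (∀ r ∈ rs, r ∈ P) ∧
      RingTheory.Sequence.IsWeaklyRegular (MvPolynomial (Fin m) ℂ) rs ∧ m ≤ d + rs.length := by
  induction m with
  | zero => intro P _ d _; exact ⟨[], by simp, RingTheory.Sequence.IsWeaklyRegular.nil _ _, by simp⟩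
  | succ m ih =>
    intro P hP d hd
    by_cases h0 : P = ⊥
    · refine ⟨[], by simp, RingTheory.Sequence.IsWeaklyRegular.nil _ _, ?_⟩
      subst h0
      have e : (MvPolynomial (Fin (m+1)) ℂ ⧸ (⊥ : Ideal (MvPolynomial (Fin (m+1)) ℂ))) ≃ₐ[ℂ]
        MvPolynomial (Fin (m+1)) ℂ := AlgEquiv.quotientBot ℂ _
      rw [e.trdeg_eq, MvPolynomial.trdeg_of_isDomain] at hd
      simp only [Cardinal.mk_fintype, Fintype.card_fin, Cardinal.lift_natCast] at hd
      have := Nat.cast_le.1 hd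
      simpa using this
    · obtain ⟨f, hfP, hf0⟩ := Submodule.exists_mem_ne_zero_of_ne_bot h0
      let e : MvPolynomial (Fin (m+1)) ℂ ≃ₐ[ℂ] Polynomial (MvPolynomial (Fin m) ℂ) :=
        (NNorm.T f).trans (finSuccEquiv ℂ m)
      obtain ⟨u, hu⟩ := NNorm.T_leadingcoeff_isUnit f hf0
      have hu' : (u : MvPolynomial (Fin m) ℂ) = (e f).leadingCoeff := hu
      let f' : Polynomial (MvPolynomial (Fin m) ℂ) := Polynomial.C (↑(u⁻¹) : MvPolynomial (Fin m) ℂ) * e f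
      have hmon : f'.Monic := by
        unfold Polynomial.Monic
        rw [Polynomial.leadingCoeff_mul, Polynomial.leadingCoeff_C, ← hu']
        simp
      let g : MvPolynomial (Fin m) ℂ →ₐ[ℂ] (MvPolynomial (Fin (m+1)) ℂ ⧸ P) :=
        ((Ideal.Quotient.mkₐ ℂ P).comp (e.symm : _ →ₐ[ℂ] _)).comp
          (Polynomial.CAlgHom (R := ℂ) (A := MvPolynomial (Fin m) ℂ))
      have hpr : (RingHom.ker g).IsPrime := RingHom.ker_isPrime _
      obtain ⟨rs, hrs, hreg, hlen⟩ := ih (RingHom.ker g) hpr d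
        ((trdeg_le_of_injective (Ideal.kerLiftAlg g) (Ideal.kerLiftAlg_injective g)).trans hd)
      refine ⟨(f' :: rs.map Polynomial.C).map e.toRingEquiv.symm, ?_,
        isWeaklyRegular_ringEquiv e.toRingEquiv _ (reg_seq_poly f' hmon rs hreg), ?_⟩
      · intro r hr
        simp only [List.map_cons, List.map_map, List.mem_cons, List.mem_map] at hr
        rcases hr with rfl | ⟨s, hs, rfl⟩
        · have : e.toRingEquiv.symm f' = e.symm (Polynomial.C (↑(u⁻¹) : MvPolynomial (Fin m) ℂ)) * f := by
            change e.symm f' = _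
            simp [f']
          rw [this]
          exact P.mul_mem_left _ hfP
        · have := hrs s hs
          rw [RingHom.mem_ker] at this
          exact Ideal.Quotient.eq_zero_iff_mem.1 this
      · simp; omega

lemma exists_reg_seq {σ : Type} [Fintype σ] (P : Ideal (MvPolynomial σ ℂ)) (hP : P.IsPrime) (d : ℕ)
    (hd : Algebra.trdeg ℂ (MvPolynomial σ ℂ ⧸ P) ≤ (d : Cardinal)) :
    ∃ rs : List (MvPolynomial σ ℂ), (∀ r ∈ rs, r ∈ P) ∧
      RingTheory.Sequence.IsWeaklyRegular (MvPolynomial σ ℂ) rs ∧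
      Fintype.card σ ≤ d + rs.length := by
  let e : MvPolynomial σ ℂ ≃ₐ[ℂ] MvPolynomial (Fin (Fintype.card σ)) ℂ :=
    renameEquiv ℂ (Fintype.equivFin σ)
  let g : MvPolynomial (Fin (Fintype.card σ)) ℂ →ₐ[ℂ] (MvPolynomial σ ℂ ⧸ P) :=
    (Ideal.Quotient.mkₐ ℂ P).comp (e.symm : _ →ₐ[ℂ] _)
  obtain ⟨rs, hrs, hreg, hlen⟩ := exists_reg_seq_fin _ (RingHom.ker g) (RingHom.ker_isPrime _) d
    ((trdeg_le_of_injective (Ideal.kerLiftAlg g) (Ideal.kerLiftAlg_injective g)).trans hd)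
  refine ⟨rs.map e.toRingEquiv.symm, ?_, isWeaklyRegular_ringEquiv e.toRingEquiv _ hreg, by simpa⟩
  intro r hr
  obtain ⟨s, hs, rfl⟩ := List.mem_map.1 hr
  have := hrs s hs
  rw [RingHom.mem_ker] at this
  exact Ideal.Quotient.eq_zero_iff_mem.1 this

section ext
variable {ℓ : ℕ} {A : Type*} [CommRing A]

/-- sign -/
def sg (A : Type*) [CommRing A] (T : Finset (Fin ℓ)) (j : Fin ℓ) : A :=
  (-1 : A) ^ ((T.filter (· < j)).card)

lemma sg_sq (T : Finset (Fin ℓ)) (j : Fin ℓ) : sg A T j * sg A T j = 1 := by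
  unfold sg
  rw [← pow_add, ← two_mul, pow_mul]; simp

lemma sg_insert (T : Finset (Fin ℓ)) (j k : Fin ℓ) (hj : j ∉ T) :
    sg A (insert j T) k = sg A T k * (if j < k then -1 else 1) := by
  unfold sg
  rw [Finset.filter_insert]
  split_ifs with h
  · rw [Finset.card_insert_of_notMem (by simp [hj]), pow_succ]
  · simp

lemma sg_erase (T : Finset (Fin ℓ)) (j k : Fin ℓ) (hj : j ∈ T) :
    sg A T k = sg A (T.erase j) k * (if j < k then -1 else 1) := by
  conv_lhs => rw [← Finset.insert_erase hj]
  exact sg_insert _ _ _ (by simp)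

lemma sg_erase' (T : Finset (Fin ℓ)) (j k : Fin ℓ) (hj : j ∈ T) :
    sg A (T.erase j) k = sg A T k * (if j < k then -1 else 1) := by
  rw [sg_erase T j k hj]; split_ifs <;> ring

lemma wedge1_eq (v : Fin ℓ → A) (μ : Finset (Fin ℓ) → A) (T : Finset (Fin ℓ)) :
    wedge1 v μ T = ∑ j ∈ T, sg A T j * v j * μ (T.erase j) := rfl

/-- contraction -/
noncomputable def contr (θ : Fin ℓ → A) (μ : Finset (Fin ℓ) → A) (T : Finset (Fin ℓ)) : A :=
  ∑ j ∈ Tᶜ, sg A T j * θ j * μ (insert j T)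

lemma wedge_anti (v w : Fin ℓ → A) (μ : Finset (Fin ℓ) → A) (T : Finset (Fin ℓ)) :
    wedge1 v (wedge1 w μ) T = - wedge1 w (wedge1 v μ) T := by
  simp only [wedge1_eq, Finset.mul_sum]
  rw [Finset.sum_comm' (t' := T) (s' := fun k => T.erase k) (by
    intro x y; simp only [Finset.mem_erase]; tauto), ← Finset.sum_neg_distrib]
  refine Finset.sum_congr rfl fun k hk => ?_
  rw [← Finset.sum_neg_distrib]
  refine Finset.sum_congr rfl fun j hj => ?_
  rw [Finset.mem_erase] at hj
  rw [Finset.erase_right_comm, sg_erase' T j k hj.2, sg_erase' T k j hk]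
  rcases lt_or_gt_of_ne hj.1 with h | h
  · rw [if_pos h, if_neg (not_lt.2 h.le)]; ring
  · rw [if_pos h, if_neg (not_lt.2 h.le)]; ring

lemma wedge_self (v : Fin ℓ → A) [IsDomain A] [CharZero A] (μ : Finset (Fin ℓ) → A)
    (T : Finset (Fin ℓ)) : wedge1 v (wedge1 v μ) T = 0 :=
  CharZero.eq_neg_self_iff.1 (wedge_anti v v μ T)

lemma homotopy (v θ : Fin ℓ → A) (μ : Finset (Fin ℓ) → A) (T : Finset (Fin ℓ)) :
    wedge1 v (contr θ μ) T + contr θ (wedge1 v μ) T = (∑ j, θ j * v j) * μ T := by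
  have h1 : wedge1 v (contr θ μ) T = ∑ j ∈ T, θ j * v j * μ T +
      ∑ j ∈ T, ∑ k ∈ Tᶜ, sg A T j * v j * (sg A (T.erase j) k * θ k * μ (insert k (T.erase j))) := by
    rw [wedge1_eq, ← Finset.sum_add_distrib]
    refine Finset.sum_congr rfl fun j hj => ?_
    rw [contr, Finset.compl_erase, Finset.sum_insert (by simpa using hj), mul_add,
      Finset.insert_erase hj, Finset.mul_sum, sg_erase' T j j hj, if_neg (lt_irrefl _)]
    congr 1
    linear_combination θ j * v j * μ T * sg_sq (A := A) T j
  have h2 : contr θ (wedge1 v μ) T = ∑ j ∈ Tᶜ, θ j * v j * μ T +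
      ∑ k ∈ Tᶜ, ∑ j ∈ T, sg A T k * θ k * (sg A (insert k T) j * v j * μ ((insert k T).erase j)) := by
    rw [contr, ← Finset.sum_add_distrib]
    refine Finset.sum_congr rfl fun k hk => ?_
    have hk' : k ∉ T := by simpa using hk
    rw [wedge1_eq, Finset.sum_insert hk', mul_add, Finset.erase_insert hk', Finset.mul_sum,
      sg_insert T k k hk', if_neg (lt_irrefl _)]
    congr 1
    linear_combination θ k * v k * μ T * sg_sq (A := A) T k
  rw [h1, h2, Finset.sum_comm (s := Tᶜ), Finset.sum_mul, ← Finset.sum_add_sum_compl T]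
  have h3 : ∑ j ∈ T, ∑ k ∈ Tᶜ, sg A T j * v j * (sg A (T.erase j) k * θ k * μ (insert k (T.erase j)))
    + ∑ j ∈ T, ∑ k ∈ Tᶜ, sg A T k * θ k * (sg A (insert k T) j * v j * μ ((insert k T).erase j)) = 0 := by
    rw [← Finset.sum_add_distrib]
    refine Finset.sum_eq_zero fun j hj => ?_
    rw [← Finset.sum_add_distrib]
    refine Finset.sum_eq_zero fun k hk => ?_
    have hk' : k ∉ T := by simpa using hk
    have hne : k ≠ j := by rintro rfl; exact hk' hj
    rw [Finset.erase_insert_of_ne hne, sg_erase' T j k hj, sg_insert T k j hk']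
    rcases lt_or_gt_of_ne hne with h | h
    · rw [if_pos h, if_neg (not_lt.2 h.le)]; ring
    · rw [if_pos h, if_neg (not_lt.2 h.le)]; ring
  linear_combination h3

lemma wedge1_sum_left {ι : Type*} (s : Finset ι) (a : ι → A) (v : ι → Fin ℓ → A)
    (μ : Finset (Fin ℓ) → A) (T : Finset (Fin ℓ)) :
    wedge1 (fun j => ∑ i ∈ s, a i * v i j) μ T = ∑ i ∈ s, a i * wedge1 (v i) μ T := by
  simp only [wedge1_eq, Finset.mul_sum, Finset.sum_mul]
  rw [Finset.sum_comm]
  refine Finset.sum_congr rfl fun j _ => Finset.sum_congr rfl fun k _ => by ring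

lemma contr_smul (θ : Fin ℓ → A) (r : A) (μ : Finset (Fin ℓ) → A) (T : Finset (Fin ℓ)) :
    contr θ (r • μ) T = r * contr θ μ T := by
  simp only [contr, Pi.smul_apply, smul_eq_mul, Finset.mul_sum]
  exact Finset.sum_congr rfl (fun j _ => by ring)

lemma dvd_wedge1 (v : Fin ℓ → A) (f : A) (μ : Finset (Fin ℓ) → A) (h : ∀ T, f ∣ μ T)
    (T : Finset (Fin ℓ)) : f ∣ wedge1 v μ T :=
  Finset.dvd_sum fun j _ => (h _).mul_left _

lemma dvd_contr (v : Fin ℓ → A) (f : A) (μ : Finset (Fin ℓ) → A) (h : ∀ T, f ∣ μ T)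
    (T : Finset (Fin ℓ)) : f ∣ contr v μ T :=
  Finset.dvd_sum fun j _ => (h _).mul_left _

end ext

section lin
variable {ℓ : ℕ} {σ : Type} (e : Fin ℓ → σ) (he : Function.Injective e)

/-- linear form -/
noncomputable def linf (c : Fin ℓ → ℂ) : MvPolynomial σ ℂ := ∑ j, C (c j) * X (e j)

include he in
lemma coeff_linf (c : Fin ℓ → ℂ) (j : Fin ℓ) : (linf e c).coeff (Finsupp.single (e j) 1) = c j := by
  classical
  unfold linf
  rw [coeff_sum, Finset.sum_eq_single j]
  · simp
  · intro k _ hk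
    rw [coeff_C_mul, coeff_X, if_neg]
    · simp
    · rw [Finsupp.single_left_inj Nat.one_ne_zero]
      exact fun h => hk (he h)
  · simp

include he in
lemma totalDegree_linf (c : Fin ℓ → ℂ) (hc : c ≠ 0) : (linf e c).totalDegree = 1 := by
  apply le_antisymm
  · apply totalDegree_finsetSum_le
    intro j _
    refine (totalDegree_mul _ _).trans ?_
    simp
  · rw [← not_lt, Nat.lt_one_iff, totalDegree_eq_zero_iff]
    intro h
    obtain ⟨i, hi⟩ := Function.ne_iff.1 hc
    have := h (Finsupp.single (e i) 1) (by rw [mem_support_iff, coeff_linf e he]; exact hi) (e i)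
    simp at this

include he in
lemma prime_linf (c : Fin ℓ → ℂ) (hc : c ≠ 0) : Prime (linf e c) := by
  apply Irreducible.prime
  apply irreducible_of_totalDegree_eq_one (totalDegree_linf e he c hc)
  intro x hx
  obtain ⟨i, hi⟩ := Function.ne_iff.1 hc
  have := hx (Finsupp.single (e i) 1)
  rw [coeff_linf e he] at this
  rw [isUnit_iff_ne_zero]
  rintro rfl
  exact hi (zero_dvd_iff.1 this)

include he in
lemma linf_not_dvd (c d : Fin ℓ → ℂ) (hc : c ≠ 0) (hd : d ≠ 0) (h : ∀ t : ℂ, d ≠ t • c) :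
    ¬ linf e c ∣ linf e d := by
  rintro ⟨u, hu⟩
  have hc0 : linf e c ≠ 0 := (prime_linf e he c hc).ne_zero
  have hd0 : linf e d ≠ 0 := (prime_linf e he d hd).ne_zero
  have hu0 : u ≠ 0 := by rintro rfl; simp at hu; exact hd0 hu
  have h1 := congrArg totalDegree hu
  rw [totalDegree_mul_of_isDomain hc0 hu0, totalDegree_linf e he c hc, totalDegree_linf e he d hd] at h1
  have h2 := totalDegree_eq_zero_iff_eq_C.1 (show u.totalDegree = 0 by omega)
  apply h (coeff 0 u)
  funext j
  rw [← coeff_linf e he d, hu, h2, mul_comm, coeff_C_mul, coeff_linf e he]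
  simp
end lin

lemma prime_prod_dvd {A : Type*} [CommRing A] [IsDomain A] {n : ℕ} (f : Fin n → A)
    (hp : ∀ i, Prime (f i)) (hnd : ∀ i k, i ≠ k → ¬ f i ∣ f k) (i : Fin n) (s : Finset (Fin n))
    (hs : i ∉ s) (x : A) (h : f i ∣ (∏ k ∈ s, f k) * x) : f i ∣ x := by
  rcases (hp i).dvd_or_dvd h with h | h
  · obtain ⟨k, hk, hk'⟩ := ((hp i).dvd_finset_prod_iff f).1 h
    exact absurd hk' (hnd i k (by rintro rfl; exact hs hk))
  · exact h

section gen
variable {A : Type*} [CommRing A] [IsDomain A] {n : ℕ} (f : Fin n → A)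
    (hp : ∀ i, Prime (f i)) (hnd : ∀ i k, i ≠ k → ¬ f i ∣ f k)

lemma prod_dvd_sum_iff {A : Type*} [CommRing A] [IsDomain A] {n : ℕ} (f : Fin n → A)
    (hp : ∀ i, Prime (f i)) (hnd : ∀ i k, i ≠ k → ¬ f i ∣ f k) (w : Fin n → A) :
    (∏ i, f i) ∣ ∑ i, (∏ k ∈ univ.erase i, f k) * w i ↔ ∀ i, f i ∣ w i := by
  classical
  constructor
  · intro h i
    have h1 : f i ∣ ∑ i, (∏ k ∈ univ.erase i, f k) * w i :=
      (Finset.dvd_prod_of_mem f (mem_univ i)).trans h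
    rw [← Finset.add_sum_erase _ _ (mem_univ i)] at h1
    have h2 : f i ∣ ∑ x ∈ univ.erase i, (∏ k ∈ univ.erase x, f k) * w x := by
      refine Finset.dvd_sum fun x hx => Dvd.dvd.mul_right ?_ _
      refine Finset.dvd_prod_of_mem f ?_
      simp only [mem_erase, mem_univ, and_true] at hx ⊢
      exact fun h => hx h.symm
    exact prime_prod_dvd f hp hnd i _ (by simp) _ ((dvd_add_left h2).1 h1)
  · intro h
    refine Finset.dvd_sum fun i _ => ?_
    rw [← Finset.mul_prod_erase _ f (mem_univ i), mul_comm]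
    exact mul_dvd_mul_left _ (h i)

lemma pderiv_prod {σ : Type} [DecidableEq σ] (s : σ) {n : ℕ} (f : Fin n → MvPolynomial σ ℂ) (t : Finset (Fin n)) :
    pderiv s (∏ i ∈ t, f i) = ∑ i ∈ t, (∏ k ∈ t.erase i, f k) * pderiv s (f i) := by
  induction t using Finset.induction_on with
  | empty => simp
  | insert a t ha ih =>
    rw [Finset.prod_insert ha, Derivation.leibniz, ih, Finset.sum_insert ha, Finset.erase_insert ha]
    simp only [smul_eq_mul]
    rw [add_comm, Finset.mul_sum]
    congr 1
    refine Finset.sum_congr rfl fun i hi => ?_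
    have : i ≠ a := by rintro rfl; exact ha hi
    rw [Finset.erase_insert_of_ne this.symm, Finset.prod_insert (by simp [ha])]
    ring

lemma pderiv_linf {ℓ : ℕ} {σ : Type} (e : Fin ℓ → σ) (he : Function.Injective e) (c : Fin ℓ → ℂ)
    (j : Fin ℓ) : pderiv (e j) (linf e c) = C (c j) := by
  classical
  unfold linf
  rw [map_sum, Finset.sum_eq_single j]
  · simp
  · intro k _ hk
    rw [Derivation.leibniz, pderiv_X_of_ne (fun h => hk (he h))]; simp
  · simp
end gen

section main
variable {ℓ n : ℕ} (c : Fin n → Fin ℓ → ℂ)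

abbrev SS (n ℓ : ℕ) := MvPolynomial (Fin n ⊕ Fin ℓ) ℂ

/-- good arrangement -/
structure Good {ℓ n : ℕ} (c : Fin n → Fin ℓ → ℂ) : Prop where
  hnz : ∀ i, c i ≠ 0
  hprop : ∀ i k, i ≠ k → ∀ t : ℂ, c i ≠ t • c k

variable {c}
lemma Good.prime (h : Good c) (i) : Prime (fS c i) :=
  prime_linf Sum.inr Sum.inr_injective (c i) (h.hnz i)
lemma Good.nd (h : Good c) (i k) (hik : i ≠ k) : ¬ fS c i ∣ fS c k :=
  linf_not_dvd Sum.inr Sum.inr_injective (c i) (c k) (h.hnz i) (h.hnz k) (h.hprop k i hik.symm)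
lemma Good.primeR (h : Good c) (i) : Prime (linf id (c i)) :=
  prime_linf id Function.injective_id (c i) (h.hnz i)
lemma Good.ndR (h : Good c) (i k) (hik : i ≠ k) : ¬ linf id (c i) ∣ linf id (c k) :=
  linf_not_dvd id Function.injective_id (c i) (c k) (h.hnz i) (h.hnz k) (h.hprop k i hik.symm)
lemma Good.Q0 (h : Good c) : QS c ≠ 0 := Finset.prod_ne_zero_iff.2 fun i _ => (h.prime i).ne_zero

variable (c)
lemma QS_eq (i : Fin n) : fS c i * Qdiv c i = QS c := Finset.mul_prod_erase _ _ (mem_univ i)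

lemma pderiv_fS (i : Fin n) (j : Fin ℓ) : pderiv (Sum.inr j) (fS c i) = C (c i j) :=
  pderiv_linf Sum.inr Sum.inr_injective (c i) j

/-- dc -/
noncomputable def dc (i : Fin n) (j : Fin ℓ) : SS n ℓ := C (c i j)

lemma Qd_eq : Qd c = fun j => ∑ i, (X (Sum.inl i) * Qdiv c i) * dc c i j := by
  funext j
  exact Finset.sum_congr rfl fun i _ => by unfold dc; ring

variable {c}
lemma isLogDer_iff (h : Good c) (θ : Fin ℓ → SS n ℓ) :
    IsLogDer c θ ↔ ∀ i, fS c i ∣ ∑ j, θ j * C (c i j) := by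
  classical
  rw [IsLogDer, Ideal.mem_span_singleton, ← prod_dvd_sum_iff (fS c) h.prime h.nd, ← QS]
  apply iff_of_eq
  congr 1
  unfold QS
  simp only [pderiv_prod, pderiv_fS, Finset.mul_sum]
  rw [Finset.sum_comm]
  exact Finset.sum_congr rfl fun i _ => Finset.sum_congr rfl fun j _ => by ring

variable (c) in
lemma pairsWith_iff (θ : Fin ℓ → SS n ℓ) (g) :
    PairsWith c θ g ↔ QS c * g = ∑ j, θ j * Qd c j := by
  rw [PairsWith]
  apply iff_of_eq
  congr 1
  unfold Qd
  simp only [pderiv_fS, Finset.mul_sum]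
  rw [Finset.sum_comm]
  exact Finset.sum_congr rfl fun i _ => Finset.sum_congr rfl fun j _ => by ring

lemma mem_Ilog (h : Good c) (g : SS n ℓ) : g ∈ Ilog c ↔ ∃ θ : Fin ℓ → SS n ℓ,
    (∀ i, fS c i ∣ ∑ j, θ j * C (c i j)) ∧ QS c * g = ∑ j, θ j * Qd c j := by
  constructor
  · intro hg
    unfold Ilog at hg
    induction hg using Submodule.span_induction with
    | mem x hx =>
      obtain ⟨θ, h1, h2⟩ := hx
      exact ⟨θ, (isLogDer_iff h θ).1 h1, (pairsWith_iff c θ x).1 h2⟩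
    | zero => exact ⟨0, by simp, by simp⟩
    | add x y _ _ hx hy =>
      obtain ⟨θ, h1, h2⟩ := hx
      obtain ⟨θ', h1', h2'⟩ := hy
      refine ⟨θ + θ', fun i => ?_, ?_⟩
      · simp only [Pi.add_apply, add_mul, Finset.sum_add_distrib]; exact dvd_add (h1 i) (h1' i)
      · simp only [Pi.add_apply, add_mul, Finset.sum_add_distrib, mul_add, h2, h2']
    | smul a x _ hx =>
      obtain ⟨θ, h1, h2⟩ := hx
      refine ⟨a • θ, fun i => ?_, ?_⟩
      · simp only [Pi.smul_apply, smul_eq_mul, mul_assoc, ← Finset.mul_sum]; exact (h1 i).mul_left _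
      · simp only [Pi.smul_apply, smul_eq_mul, mul_assoc, ← Finset.mul_sum, ← h2]; ring
  · rintro ⟨θ, h1, h2⟩
    exact Submodule.subset_span ⟨θ, (isLogDer_iff h θ).2 h1, (pairsWith_iff c θ g).2 h2⟩

variable (c)
/-- log forms of degree p-1 over S -/
noncomputable def Lsub (p : ℕ) : Submodule (SS n ℓ) (Finset (Fin ℓ) → SS n ℓ) where
  carrier := {μ | (∀ T, T.card + 1 ≠ p → μ T = 0) ∧ ∀ i T, fS c i ∣ wedge1 (dc c i) μ T}
  add_mem' := by
    rintro a b ⟨ha1, ha2⟩ ⟨hb1, hb2⟩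
    refine ⟨fun T hT => by simp [Pi.add_apply, ha1 T hT, hb1 T hT], fun i T => ?_⟩
    rw [wedge1_add]
    exact dvd_add (ha2 i T) (hb2 i T)
  zero_mem' := ⟨fun _ _ => rfl, fun i T => by simp [wedge1]⟩
  smul_mem' := by
    rintro r a ⟨ha1, ha2⟩
    refine ⟨fun T hT => by simp [ha1 T hT], fun i T => ?_⟩
    rw [wedge1_smul]
    exact Dvd.dvd.mul_left (ha2 i T) r

/-- wedge with Qd -/
noncomputable def Wm : (Finset (Fin ℓ) → SS n ℓ) →ₗ[SS n ℓ] (Finset (Fin ℓ) → SS n ℓ) where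
  toFun μ := wedge1 (Qd c) μ
  map_add' a b := funext fun T => wedge1_add _ a b T
  map_smul' r a := funext fun T => wedge1_smul _ r a T

/-- boundaries -/
noncomputable def Bsub (p : ℕ) : Submodule (SS n ℓ) (Finset (Fin ℓ) → SS n ℓ) :=
  ((Lsub c p).map (Wm c)).comap (LinearMap.lsmul (SS n ℓ) _ (QS c))

lemma mem_Bsub (p : ℕ) (ν) : ν ∈ Bsub c p ↔ ∃ μ ∈ Lsub c p, Wm c μ = QS c • ν := Iff.rfl

lemma Wm_apply (μ T) : Wm c μ T = ∑ i, X (Sum.inl i) * Qdiv c i * wedge1 (dc c i) μ T := by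
  show wedge1 (Qd c) μ T = _
  rw [Qd_eq, wedge1_sum_left]

lemma Lsub_zero : Lsub c 0 = ⊥ := by
  rw [eq_bot_iff]
  intro μ hμ
  exact funext fun T => hμ.1 T (by omega)

lemma Wm_Wm (μ) : Wm c (Wm c μ) = 0 := funext fun T => wedge_self _ μ T

variable {c}
lemma exists_nu (h : Good c) {p : ℕ} {μ} (hμ : μ ∈ Lsub c p) :
    ∃ ν ∈ Lsub c (p+1), Wm c μ = QS c • ν := by
  choose w hw using hμ.2
  have e1 : Wm c μ = QS c • (fun T => ∑ i, X (Sum.inl i) * w i T) := by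
    funext T
    rw [Wm_apply, Pi.smul_apply, smul_eq_mul, Finset.mul_sum]
    refine Finset.sum_congr rfl fun i _ => ?_
    rw [hw, ← QS_eq c i]; ring
  refine ⟨_, ⟨?_, ?_⟩, e1⟩
  · intro T hT
    refine Finset.sum_eq_zero fun i _ => ?_
    have : fS c i * w i T = 0 := by
      rw [← hw, wedge1_eq]
      refine Finset.sum_eq_zero fun j hj => ?_
      rw [hμ.1, mul_zero]
      rw [Finset.card_erase_add_one hj]; omega
    rw [(mul_eq_zero.1 this).resolve_left (h.prime i).ne_zero, mul_zero]
  · intro k T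
    have hsum : wedge1 (dc c k) (fun T => ∑ i, X (Sum.inl i) * w i T) T =
        ∑ i, X (Sum.inl i) * wedge1 (dc c k) (w i) T := by
      simp only [wedge1_eq, Finset.mul_sum]
      rw [Finset.sum_comm]
      exact Finset.sum_congr rfl fun i _ => Finset.sum_congr rfl fun j _ => by ring
    rw [hsum]
    refine Finset.dvd_sum fun i _ => Dvd.dvd.mul_left ?_ _
    have h1 : fS c i * wedge1 (dc c k) (w i) T = wedge1 (dc c k) (wedge1 (dc c i) μ) T := by
      rw [← wedge1_smul]; congr 1; funext T; rw [hw]; rfl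
    by_cases hik : k = i
    · subst hik
      rw [wedge_self] at h1
      rw [(mul_eq_zero.1 h1).resolve_left (h.prime k).ne_zero]
      exact dvd_zero _
    · have h2 : fS c k ∣ fS c i * wedge1 (dc c k) (w i) T := by
        rw [h1, wedge_anti, dvd_neg]
        exact dvd_wedge1 _ _ _ (hμ.2 k) T
      exact ((h.prime k).dvd_or_dvd h2).resolve_left (h.nd k i hik)

lemma smul_inj (h : Good c) {a b : Finset (Fin ℓ) → SS n ℓ} (hab : QS c • a = QS c • b) : a = b := by
  funext T
  exact mul_left_cancel₀ h.Q0 (congrFun hab T)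

lemma Bsub_le (h : Good c) (p : ℕ) : Bsub c p ≤ Lsub c (p+1) := by
  intro ν hν
  obtain ⟨μ, hμ, e⟩ := (mem_Bsub c p ν).1 hν
  obtain ⟨ν', h1, h2⟩ := exists_nu h hμ
  rwa [smul_inj h (e.symm.trans h2)]

lemma Bsub_W (h : Good c) (p : ℕ) : Bsub c p ≤ LinearMap.ker (Wm c) := by
  intro ν hν
  obtain ⟨μ, hμ, e⟩ := (mem_Bsub c p ν).1 hν
  rw [LinearMap.mem_ker]
  apply smul_inj h
  rw [← map_smul, ← e, Wm_Wm, smul_zero]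

lemma contr_mem (h : Good c) {p : ℕ} {μ} (hμ : μ ∈ Lsub c (p+1)) (θ : Fin ℓ → SS n ℓ)
    (hθ : ∀ i, fS c i ∣ ∑ j, θ j * C (c i j)) : contr θ μ ∈ Lsub c p := by
  refine ⟨fun T hT => ?_, fun i T => ?_⟩
  · refine Finset.sum_eq_zero fun j hj => ?_
    rw [hμ.1, mul_zero]
    rw [Finset.card_insert_of_notMem (by simpa using hj)]; omega
  · have := homotopy (dc c i) θ μ T
    rw [eq_sub_of_add_eq this]
    exact dvd_sub ((hθ i).mul_right _) (dvd_contr _ _ _ (hμ.2 i) _)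

lemma Ilog_mul (h : Good c) {p : ℕ} {μ} (hμ : μ ∈ Lsub c (p+1)) (hW : Wm c μ = 0) {g : SS n ℓ}
    (hg : g ∈ Ilog c) : g • μ ∈ Bsub c p := by
  obtain ⟨θ, h1, h2⟩ := (mem_Ilog h g).1 hg
  refine (mem_Bsub c p _).2 ⟨contr θ μ, contr_mem h hμ θ h1, funext fun T => ?_⟩
  have := homotopy (Qd c) θ μ T
  have h0 : contr θ (wedge1 (Qd c) μ) T = 0 := by
    have : wedge1 (Qd c) μ = 0 := hW
    rw [this]; simp [contr]
  rw [h0, add_zero, ← h2] at this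
  show wedge1 (Qd c) (contr θ μ) T = QS c * (g * μ T)
  rw [this, mul_assoc]
end main

section tens
variable {ℓ n : ℕ}

/-- algebra structure -/
@[reducible] noncomputable def algRS (ℓ n : ℕ) : Algebra (MvPolynomial (Fin ℓ) ℂ) (SS n ℓ) :=
  (rename (R := ℂ) (Sum.inr : Fin ℓ → Fin n ⊕ Fin ℓ)).toRingHom.toAlgebra

attribute [local instance] algRS

lemma algRS_smul (r : MvPolynomial (Fin ℓ) ℂ) (s : SS n ℓ) : r • s = rename Sum.inr r * s := rfl

lemma sumAlg_rename (r : MvPolynomial (Fin ℓ) ℂ) :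
    sumAlgEquiv ℂ (Fin n) (Fin ℓ) (rename Sum.inr r) = C r := by
  induction r using MvPolynomial.induction_on with
  | C a => simp
  | add p q hp hq => simp [hp, hq]
  | mul_X p i hp => simp [hp]

/-- linear equiv -/
noncomputable def eRS (ℓ n : ℕ) : SS n ℓ ≃ₗ[MvPolynomial (Fin ℓ) ℂ] MvPolynomial (Fin n) (MvPolynomial (Fin ℓ) ℂ) :=
  { sumAlgEquiv ℂ (Fin n) (Fin ℓ) with
    map_smul' := fun r s => by
      show sumAlgEquiv ℂ (Fin n) (Fin ℓ) (r • s) = r • sumAlgEquiv ℂ (Fin n) (Fin ℓ) s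
      rw [algRS_smul, map_mul, sumAlg_rename, C_mul'] }

instance freeRS : Module.Free (MvPolynomial (Fin ℓ) ℂ) (SS n ℓ) :=
  Module.Free.of_equiv (eRS ℓ n).symm

/-- coefficient -/
noncomputable def cf (m : Fin n →₀ ℕ) (s : SS n ℓ) : MvPolynomial (Fin ℓ) ℂ :=
  coeff m (sumAlgEquiv ℂ (Fin n) (Fin ℓ) s)

lemma cf_dvd (r : MvPolynomial (Fin ℓ) ℂ) (s : SS n ℓ) (h : rename Sum.inr r ∣ s) (m) : r ∣ cf m s := by
  have := map_dvd (sumAlgEquiv ℂ (Fin n) (Fin ℓ)) h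
  rw [sumAlg_rename, C_dvd_iff_dvd_coeff] at this
  exact this m

lemma cf_mul (r : MvPolynomial (Fin ℓ) ℂ) (s : SS n ℓ) (m) : cf m (rename Sum.inr r * s) = r * cf m s := by
  unfold cf
  rw [map_mul, sumAlg_rename, coeff_C_mul]

lemma cf_sum {ι : Type} (t : Finset ι) (s : ι → SS n ℓ) (m) :
    cf m (∑ i ∈ t, s i) = ∑ i ∈ t, cf m (s i) := by
  unfold cf
  rw [map_sum, coeff_sum]

lemma cf_wedge (c : Fin ℓ → ℂ) (μ : Finset (Fin ℓ) → SS n ℓ) (m : Fin n →₀ ℕ) (T) :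
    cf m (wedge1 (fun j => C (c j)) μ T) = wedge1 (fun j => C (c j)) (fun T => cf m (μ T)) T := by
  unfold wedge1
  rw [cf_sum]
  refine Finset.sum_congr rfl fun j _ => ?_
  rw [← cf_mul]
  simp

lemma cf_exp (s : SS n ℓ) (u : Finset (Fin n →₀ ℕ))
    (hu : (sumAlgEquiv ℂ (Fin n) (Fin ℓ) s).support ⊆ u) :
    s = ∑ m ∈ u, rename Sum.inr (cf m s) * (sumAlgEquiv ℂ (Fin n) (Fin ℓ)).symm (monomial m 1) := by
  apply (sumAlgEquiv ℂ (Fin n) (Fin ℓ)).injective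
  rw [map_sum]
  simp only [map_mul, sumAlg_rename, AlgEquiv.apply_symm_apply, C_mul_monomial, mul_one]
  conv_lhs => rw [(sumAlgEquiv ℂ (Fin n) (Fin ℓ) s).as_sum]
  refine Finset.sum_subset hu fun m _ hm => ?_
  rw [notMem_support_iff.1 hm]; simp

variable {c : Fin n → Fin ℓ → ℂ}

lemma mem_logForms (h : Good c) (p : ℕ) (μ) : μ ∈ logForms ℓ (Qx c) p ↔
    (∀ T, T.card ≠ p → μ T = 0) ∧ ∀ i T, linf id (c i) ∣ wedge1 (fun j => C (c i j)) μ T := by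
  show (_ ∧ _) ↔ _
  refine and_congr_right fun _ => ?_
  rw [forall_comm]
  refine forall_congr' fun T => ?_
  rw [← prod_dvd_sum_iff (fun i => linf id (c i)) h.primeR h.ndR]
  have : (fun j => pderiv j (Qx c)) = fun j => ∑ i, (∏ k ∈ univ.erase i, linf id (c k)) * C (c i j) := by
    funext j
    have : Qx c = ∏ i, linf id (c i) := rfl
    rw [this, pderiv_prod]
    refine Finset.sum_congr rfl fun i _ => ?_
    rw [← pderiv_linf id Function.injective_id]; rfl
  rw [this, wedge1_sum_left]; rfl

/-- tensor map -/
noncomputable def tauM (c : Fin n → Fin ℓ → ℂ) (p : ℕ) :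
    TensorProduct (MvPolynomial (Fin ℓ) ℂ) (SS n ℓ) (logForms ℓ (Qx c) p) →ₗ[SS n ℓ]
      (Finset (Fin ℓ) → SS n ℓ) :=
  (TensorProduct.piScalarRight (MvPolynomial (Fin ℓ) ℂ) (SS n ℓ) (SS n ℓ) (Finset (Fin ℓ))).toLinearMap ∘ₗ
    LinearMap.baseChange (SS n ℓ) (logForms ℓ (Qx c) p).subtype

lemma tauM_inj (p : ℕ) : Function.Injective (tauM c p) := by
  unfold tauM
  rw [LinearMap.coe_comp]
  refine (LinearEquiv.injective _).comp ?_
  exact Module.Flat.lTensor_preserves_injective_linearMap _ (Submodule.injective_subtype _)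

lemma tauM_tmul (p : ℕ) (s : SS n ℓ) (μ : logForms ℓ (Qx c) p) :
    tauM c p (TensorProduct.tmul _ s μ) = fun T => rename Sum.inr (μ.1 T) * s := by
  unfold tauM
  simp only [LinearMap.comp_apply, LinearMap.baseChange_tmul]
  rfl

lemma rename_linf (i : Fin n) : rename Sum.inr (linf id (c i)) = fS c i := by
  simp [linf, fS]

lemma tauM_range (h : Good c) (p : ℕ) : LinearMap.range (tauM c p) = Lsub c (p+1) := by
  apply le_antisymm
  · rintro _ ⟨x, rfl⟩
    induction x using TensorProduct.induction_on with
    | zero => rw [map_zero]; exact zero_mem _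
    | add x y hx hy => rw [map_add]; exact add_mem hx hy
    | tmul s μ =>
      rw [tauM_tmul]
      have hμ := (mem_logForms h p μ.1).1 μ.2
      refine ⟨fun T hT => ?_, fun i T => ?_⟩
      · dsimp only
        rw [hμ.1 T (by omega)]; simp
      · have := map_dvd (rename (R := ℂ) (Sum.inr : Fin ℓ → Fin n ⊕ Fin ℓ)) (hμ.2 i T)
        rw [rename_linf] at this
        have e : wedge1 (dc c i) (fun T => rename Sum.inr (μ.1 T) * s) T =
            rename Sum.inr (wedge1 (fun j => C (c i j)) μ.1 T) * s := by
          unfold wedge1 dc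
          rw [map_sum, Finset.sum_mul]
          refine Finset.sum_congr rfl fun j _ => ?_
          simp; ring
        rw [e]
        exact this.mul_right _
  · intro ν hν
    let u : Finset (Fin n →₀ ℕ) := univ.biUnion fun T => (sumAlgEquiv ℂ (Fin n) (Fin ℓ) (ν T)).support
    have hm : ∀ m : Fin n →₀ ℕ, (fun T => cf m (ν T)) ∈ logForms ℓ (Qx c) p := by
      intro m
      rw [mem_logForms h]
      refine ⟨fun T hT => ?_, fun i T => ?_⟩
      · show cf m (ν T) = 0
        rw [hν.1 T (by omega)]; simp [cf]
      · rw [← cf_wedge]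
        apply cf_dvd
        rw [rename_linf]
        exact hν.2 i T
    have : ν = ∑ m ∈ u, tauM c p (TensorProduct.tmul _
        ((sumAlgEquiv ℂ (Fin n) (Fin ℓ)).symm (monomial m 1)) ⟨_, hm m⟩) := by
      funext T
      simp only [tauM_tmul, Finset.sum_apply]
      apply cf_exp
      exact Finset.subset_biUnion_of_mem (fun T => (sumAlgEquiv ℂ (Fin n) (Fin ℓ) (ν T)).support) (mem_univ T)
    rw [this]
    exact sum_mem fun m _ => ⟨_, rfl⟩

lemma vext_Lsub (h : Good c) (htame : ArrTame c) {N : Type} [AddCommGroup N] [Module (SS n ℓ) N]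
    (rs : List (SS n ℓ)) (hreg : RingTheory.Sequence.IsWeaklyRegular (SS n ℓ) rs)
    (hN : ∀ r ∈ rs, ∀ x : N, r • x = 0) (p k : ℕ) (hp : p ≤ ℓ) (hk : k + p ≤ rs.length) :
    VExt (SS n ℓ) N (Lsub c (p+1)) k := by
  have := vext_pd (R := MvPolynomial (Fin ℓ) ℂ) rs hreg hN p _ k hk (htame p hp)
  exact vext_equiv ((LinearEquiv.ofInjective _ (tauM_inj p)).trans
    (LinearEquiv.ofEq _ _ (tauM_range h p))) this
end tens

section acyc
variable {ℓ n : ℕ} {c : Fin n → Fin ℓ → ℂ}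

/-- cokernel -/
abbrev Cq (c : Fin n → Fin ℓ → ℂ) (p : ℕ) := Lsub c (p+1) ⧸ (Bsub c p).comap (Lsub c (p+1)).subtype

/-- annihilation -/
lemma vext_Cq (h : Good c) {N : Type} [AddCommGroup N] [Module (SS n ℓ) N] (p k : ℕ)
    (hB : VExt (SS n ℓ) N (Bsub c p) (k+1)) (hL : VExt (SS n ℓ) N (Lsub c (p+1)) k) :
    VExt (SS n ℓ) N (Cq c p) k := by
  refine vext_ses (Submodule.inclusion (Bsub_le h p)) (Submodule.mkQ _)
    (Submodule.inclusion_injective _) (Submodule.mkQ_surjective _) ?_ hB hL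
  intro x
  rw [← LinearMap.mem_ker, Submodule.ker_mkQ]
  constructor
  · intro hx
    exact ⟨⟨x.1, hx⟩, rfl⟩
  · rintro ⟨y, rfl⟩
    exact y.2

/-- the boundary map -/
lemma vext_B_succ (h : Good c) {N : Type} [AddCommGroup N] [Module (SS n ℓ) N] (p k : ℕ)
    (hZ : ∀ μ ∈ Lsub c (p+1), Wm c μ = 0 → μ ∈ Bsub c p)
    (hC : VExt (SS n ℓ) N (Cq c p) k) : VExt (SS n ℓ) N (Bsub c (p+1)) k := by
  -- Lsub(p+1) → map W
  let φ : Lsub c (p+1) →ₗ[SS n ℓ] (Finset (Fin ℓ) → SS n ℓ) := (Wm c) ∘ₗ (Lsub c (p+1)).subtype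
  have hker : LinearMap.ker φ = (Bsub c p).comap (Lsub c (p+1)).subtype := by
    ext x
    constructor
    · intro hx; exact hZ x.1 x.2 hx
    · intro hx; exact Bsub_W h p hx
  let ψ : Bsub c (p+1) →ₗ[SS n ℓ] (Finset (Fin ℓ) → SS n ℓ) :=
    (LinearMap.lsmul (SS n ℓ) _ (QS c)) ∘ₗ (Bsub c (p+1)).subtype
  have hψ : Function.Injective ψ := by
    intro a b hab
    exact Subtype.ext (smul_inj h hab)
  have hr : LinearMap.range φ = LinearMap.range ψ := by
    ext x
    constructor
    · rintro ⟨μ, rfl⟩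
      obtain ⟨ν, h1, h2⟩ := exists_nu h μ.2
      exact ⟨⟨ν, (mem_Bsub _ _ _).2 ⟨μ.1, μ.2, h2⟩⟩, h2.symm⟩
    · rintro ⟨ν, rfl⟩
      obtain ⟨μ, h1, h2⟩ := (mem_Bsub _ _ _).1 ν.2
      exact ⟨⟨μ, h1⟩, h2⟩
  exact vext_equiv ((Submodule.quotEquivOfEq _ _ hker.symm).trans (φ.quotKerEquivRange.trans
    ((LinearEquiv.ofEq _ _ hr).trans (LinearEquiv.ofInjective ψ hψ).symm))) hC

lemma vext_bot {N : Type} [AddCommGroup N] [Module (SS n ℓ) N] (h : Good c) (k : ℕ) :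
    VExt (SS n ℓ) N (Bsub c 0) k := by
  have : Bsub c 0 = ⊥ := by
    rw [eq_bot_iff]
    intro ν hν
    obtain ⟨μ, h1, h2⟩ := (mem_Bsub _ _ _).1 hν
    rw [Lsub_zero] at h1
    rw [(Submodule.mem_bot _).1 h1, map_zero] at h2
    exact smul_inj h (by rw [← h2, smul_zero])
  rw [this]
  intro i _
  have hz : CategoryTheory.Limits.IsZero (ModuleCat.of (SS n ℓ) (⊥ : Submodule (SS n ℓ) (Finset (Fin ℓ) → SS n ℓ))) :=
    ModuleCat.isZero_of_subsingleton _
  refine ⟨fun a b => ?_⟩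
  have hid : CategoryTheory.CategoryStruct.id (ModuleCat.of (SS n ℓ) (⊥ : Submodule (SS n ℓ) (Finset (Fin ℓ) → SS n ℓ))) = 0 :=
    hz.eq_of_src _ _
  rw [← CategoryTheory.Abelian.Ext.comp_mk₀_id a, ← CategoryTheory.Abelian.Ext.comp_mk₀_id b, hid]
  simp

/-- regular sequence bounds -/
def RegB (c : Fin n → Fin ℓ → ℂ) : Prop := ∀ P : Ideal (SS n ℓ), P.IsPrime → Ilog c ≤ P →
  ∃ rs : List (SS n ℓ), (∀ r ∈ rs, r ∈ P) ∧ RingTheory.Sequence.IsWeaklyRegular (SS n ℓ) rs ∧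
    ℓ ≤ rs.length ∧ (QS c ∈ P → ℓ + 1 ≤ rs.length)

lemma quot_ann (P : Ideal (SS n ℓ)) (rs : List (SS n ℓ)) (h : ∀ r ∈ rs, r ∈ P) :
    ∀ r ∈ rs, ∀ x : SS n ℓ ⧸ P, r • x = 0 := by
  intro r hr x
  obtain ⟨y, rfl⟩ := Ideal.Quotient.mk_surjective x
  rw [← Ideal.Quotient.mk_eq_mk, ← Submodule.Quotient.mk_smul, Submodule.Quotient.mk_eq_zero]
  exact P.mul_mem_right y (h r hr)


/-- vanishing statement -/
def VC (c : Fin n → Fin ℓ → ℂ) (p : ℕ) : Prop := ∀ (N : Type) [AddCommGroup N] [Module (SS n ℓ) N] (rs : List (SS n ℓ)),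
      RingTheory.Sequence.IsWeaklyRegular (SS n ℓ) rs → (∀ r ∈ rs, ∀ x : N, r • x = 0) →
      ∀ k, k + p ≤ rs.length → VExt (SS n ℓ) N (Cq c p) k

lemma ass_contra (hR : RegB c) (p : ℕ) (hV : VC c p) (μ) (hμ : μ ∈ Lsub c (p+1))
    (hI : ∀ g ∈ Ilog c, g • μ ∈ Bsub c p) (hpl : p < ℓ ∨ (p ≤ ℓ ∧ QS c • μ ∈ Bsub c p)) :
    μ ∈ Bsub c p := by
  by_contra hn
  let x : Cq c p := Submodule.Quotient.mk ⟨μ, hμ⟩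
  have hx : x ≠ 0 := fun h0 => by
    have := (Submodule.Quotient.mk_eq_zero ((Bsub c p).comap (Lsub c (p+1)).subtype)).1 h0
    exact hn this
  have key : ∀ g : SS n ℓ, g • μ ∈ Bsub c p → g ∈ (⊥ : Submodule (SS n ℓ) (Cq c p)).colon {x} := by
    intro g hg
    rw [Submodule.mem_colon_singleton, Submodule.mem_bot, ← Submodule.Quotient.mk_smul,
      Submodule.Quotient.mk_eq_zero]
    exact hg
  obtain ⟨P, hP, hle⟩ := exists_le_isAssociatedPrime_of_isNoetherianRing (SS n ℓ) x hx
  obtain ⟨rs, h1, h2, h3, h4⟩ := hR P hP.isPrime fun g hg => hle (key g (hI g hg))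
  refine vext_ass hP (hV _ rs h2 (quot_ann P rs h1) 1 ?_)
  rcases hpl with h | ⟨h, hQ⟩
  · omega
  · have := h4 (hle (key _ hQ)); omega

lemma acyc (h : Good c) (htame : ArrTame c) (hR : RegB c) (p : ℕ) (hp : p ≤ ℓ) : VC c p := by
  induction p with
  | zero =>
    exact fun N _ _ rs hreg hN k hk =>
        vext_Cq h 0 k (vext_bot h _) (vext_Lsub h htame rs hreg hN 0 k hp hk)
  | succ p ih =>
    intro N _ _ rs hreg hN k hk
    refine vext_Cq h _ k (vext_B_succ h p (k+1) ?_ (ih (by omega) N rs hreg hN _ (by omega)))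
      (vext_Lsub h htame rs hreg hN _ k hp hk)
    intro μ hμ hW
    exact ass_contra hR p (ih (by omega)) μ hμ (fun g hg => Ilog_mul h hμ hW hg) (Or.inl (by omega))

/-- top form -/
noncomputable def topf (n ℓ : ℕ) (g : SS n ℓ) : Finset (Fin ℓ) → SS n ℓ := fun T => if T = univ then g else 0

lemma wedge_top (v : Fin ℓ → SS n ℓ) (g) (T) : wedge1 v (topf n ℓ g) T = 0 := by
  refine Finset.sum_eq_zero fun j _ => ?_
  rw [topf, if_neg, mul_zero]
  intro h
  have := Finset.mem_univ j
  rw [← h] at this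
  simp at this

lemma topf_mem (g) : topf n ℓ g ∈ Lsub c (ℓ+1) := by
  refine ⟨fun T hT => ?_, fun i T => by rw [wedge_top]; exact dvd_zero _⟩
  rw [topf, if_neg]
  rintro rfl
  simp at hT

lemma topf_iff (h : Good c) (g : SS n ℓ) : topf n ℓ g ∈ Bsub c ℓ ↔ g ∈ Ilog c := by
  constructor
  · intro hg
    obtain ⟨μ, h1, h2⟩ := (mem_Bsub _ _ _).1 hg
    rw [mem_Ilog h]
    refine ⟨fun j => sg _ univ j * μ (univ.erase j), fun i => ?_, ?_⟩
    · have := h1.2 i univ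
      rw [wedge1_eq] at this
      convert this using 1
      exact Finset.sum_congr rfl fun j _ => by unfold dc; ring
    · have := congrFun h2 univ
      simp only [Pi.smul_apply, topf, if_true, smul_eq_mul] at this
      rw [← this]
      show wedge1 (Qd c) μ univ = _
      rw [wedge1_eq]
      exact Finset.sum_congr rfl fun j _ => by ring
  · intro hg
    have := Ilog_mul h (topf_mem (c := c) (1 : SS n ℓ)) (funext fun T => wedge_top _ _ T) hg
    convert this using 1
    funext T
    simp [topf]

lemma Q_sat (h : Good c) (htame : ArrTame c) (hR : RegB c) (g : SS n ℓ) (hg : QS c * g ∈ Ilog c) :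
    g ∈ Ilog c := by
  rw [← topf_iff h]
  refine ass_contra hR ℓ (acyc h htame hR ℓ le_rfl) _ (topf_mem g) ?_ (Or.inr ⟨le_rfl, ?_⟩)
  · intro a ha
    convert (topf_iff h (a * g)).2 ((Ilog c).mul_mem_right g ha) using 1
    funext T; simp [topf]
  · convert (topf_iff h _).2 hg using 1
    funext T; simp [topf]

end acyc

section LA
variable {ℓ n : ℕ}

lemma gen_inv {V W : Type} [AddCommGroup V] [AddCommGroup W] [Module ℂ V] [Module ℂ W] (g : V →ₗ[ℂ] W) :
    ∃ B : W →ₗ[ℂ] V, ∀ v, g (B (g v)) = g v := by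
  obtain ⟨s, hs⟩ := LinearMap.exists_rightInverse_of_surjective g.rangeRestrict (LinearMap.range_rangeRestrict g)
  obtain ⟨B, hB⟩ := LinearMap.exists_extend s
  refine ⟨B, fun v => ?_⟩
  have h1 : B (g v) = s (g.rangeRestrict v) := by
    rw [← hB]; rfl
  rw [h1]
  have := congrArg Subtype.val (LinearMap.congr_fun hs (g.rangeRestrict v))
  exact this

variable {K : Type} [Field K] [Algebra ℂ K]

/-- truncated matrix -/
noncomputable def Mt (c : Fin n → Fin ℓ → ℂ) (X : Finset (Fin n)) : Matrix (Fin n) (Fin ℓ) ℂ :=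
  Matrix.of fun i => if i ∈ X then c i else 0

lemma Mt_ker (c : Fin n → Fin ℓ → ℂ) (X : Finset (Fin n)) (v : Fin ℓ → ℂ) (hv : (Mt c X).mulVecLin v = 0) :
    ∀ i ∈ X, ∑ j, c i j * v j = 0 := by
  intro i hi
  have := congrFun hv i
  simpa [Mt, Matrix.mulVec, dotProduct, hi] using this

lemma Mt_row (c : Fin n → Fin ℓ → ℂ) (X : Finset (Fin n)) (x : Fin ℓ → K)
    (h1 : ∀ i ∈ X, ∑ j, c i j • x j = 0) (k : Fin n) : ∑ j, Mt c X k j • x j = 0 := by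
  by_cases hk : k ∈ X
  · simpa [Mt, hk] using h1 k hk
  · simp [Mt, hk]

lemma LA0 (c : Fin n → Fin ℓ → ℂ) (X : Finset (Fin n)) (x : Fin ℓ → K) (z : Fin n → K)
    (h1 : ∀ i ∈ X, ∑ j, c i j • x j = 0)
    (h2 : ∀ v : Fin ℓ → ℂ, (∀ i ∈ X, ∑ j, c i j * v j = 0) → ∑ i, (∑ j, c i j * v j) • z i = 0) :
    ∑ i, z i * ∑ j, c i j • x j = 0 := by
  classical
  obtain ⟨B, hB⟩ := gen_inv (Mt c X).mulVecLin
  let L := (Mt c X).mulVecLin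
  let ψ : Fin n → (Fin ℓ → ℂ) →ₗ[ℂ] ℂ := fun i => LinearMap.lsum ℂ (fun _ => ℂ) ℂ fun j => c i j • LinearMap.id
  have hψ : ∀ i v, ψ i v = ∑ j, c i j * v j := fun i v => by simp [ψ]
  have h3 : ∀ j : Fin ℓ, ∑ i, (ψ i (Pi.single j 1) - ψ i (B (L (Pi.single j 1)))) • z i = 0 := by
    intro j
    have := h2 (Pi.single j 1 - B (L (Pi.single j 1))) (Mt_ker c X _ (by
      rw [map_sub, hB, sub_self]))
    simp only [← hψ, map_sub] at this
    exact this
  have h4 : ∀ i, ∑ j, ψ i (B (L (Pi.single j 1))) • x j = 0 := by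
    intro i
    have h5 : ∀ j, ψ i (B (L (Pi.single j 1))) = ∑ k, Mt c X k j * ψ i (B (Pi.single k 1)) := by
      intro j
      have : L (Pi.single j 1) = ∑ k, Mt c X k j • (Pi.single k 1 : Fin n → ℂ) := by
        funext k
        simp [L, Finset.sum_apply, Pi.single_apply]
      rw [this]
      simp
    simp only [h5, Finset.sum_smul]
    rw [Finset.sum_comm]
    refine Finset.sum_eq_zero fun k _ => ?_
    have := congrArg (fun t => ψ i (B (Pi.single k 1)) • t) (Mt_row c X x h1 k)
    simp only [Finset.smul_sum, smul_zero, smul_smul] at this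
    rw [← this]
    exact Finset.sum_congr rfl fun j _ => by rw [mul_comm]
  have h6 : ∀ i j, ψ i (Pi.single j 1) = c i j := fun i j => by simp [hψ, Pi.single_apply]
  have h7 : ∑ j, x j * ∑ i, (ψ i (Pi.single j 1) - ψ i (B (L (Pi.single j 1)))) • z i = 0 :=
    Finset.sum_eq_zero fun j _ => by rw [h3, mul_zero]
  simp only [Finset.mul_sum] at h7
  rw [Finset.sum_comm] at h7
  rw [← h7]
  refine Finset.sum_congr rfl fun i _ => ?_
  rw [Finset.mul_sum]
  have h8 := congrArg (fun t => z i * t) (h4 i)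
  simp only [mul_zero, Finset.mul_sum] at h8
  rw [← sub_zero (∑ j, z i * c i j • x j), ← h8, ← Finset.sum_sub_distrib]
  refine Finset.sum_congr rfl fun j _ => ?_
  rw [h6, Algebra.smul_def, Algebra.smul_def, Algebra.smul_def, map_sub]; ring

lemma c_inj (c : Fin n → Fin ℓ → ℂ) (hess : Submodule.span ℂ (Set.range c) = ⊤) (v : Fin ℓ → ℂ)
    (hv : ∀ i, ∑ j, c i j * v j = 0) : v = 0 := by
  have : ∀ w : Fin ℓ → ℂ, ∑ j, w j * v j = 0 := by
    intro w
    have hw : w ∈ Submodule.span ℂ (Set.range c) := by rw [hess]; trivial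
    induction hw using Submodule.span_induction with
    | mem w hw => obtain ⟨i, rfl⟩ := hw; exact hv i
    | zero => simp
    | add a b _ _ ha hb => simp [add_mul, Finset.sum_add_distrib, ha, hb]
    | smul r a _ ha => simp [mul_assoc, ← Finset.mul_sum, ha]
  funext j
  simpa [Pi.single_apply] using this (Pi.single j 1)

/-- the map -/
noncomputable def PhiM (x : Fin ℓ → K) (z : Fin n → K) : ((Fin ℓ → ℂ) × (Fin n → ℂ)) →ₗ[ℂ] K :=
  (Fintype.linearCombination ℂ x).coprod (Fintype.linearCombination ℂ z)

lemma PhiM_apply (x : Fin ℓ → K) (z : Fin n → K) (w t) :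
    PhiM x z (w, t) = ∑ j, w j • x j + ∑ i, t i • z i := by
  simp [PhiM, Fintype.linearCombination_apply]

lemma LA1 (c : Fin n → Fin ℓ → ℂ) (hess : Submodule.span ℂ (Set.range c) = ⊤)
    (X : Finset (Fin n)) (x : Fin ℓ → K) (z : Fin n → K)
    (h1 : ∀ i ∈ X, ∑ j, c i j • x j = 0)
    (h2 : ∀ v : Fin ℓ → ℂ, (∀ i ∈ X, ∑ j, c i j * v j = 0) → ∑ i, (∑ j, c i j * v j) • z i = 0)
    (h3 : ∑ i ∈ X, z i = 0) :
    Module.finrank ℂ (LinearMap.range (PhiM x z)) ≤ n ∧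
    (X.Nonempty → Module.finrank ℂ (LinearMap.range (PhiM x z)) + 1 ≤ n) := by
  classical
  let U := LinearMap.ker (Mt c X).mulVecLin
  let N1 := Submodule.span ℂ (Set.range (Mt c X).row)
  have hdim : Module.finrank ℂ N1 + Module.finrank ℂ U = ℓ := by
    rw [← Matrix.rank_eq_finrank_span_row, Matrix.rank]
    rw [LinearMap.finrank_range_add_finrank_ker]; simp
  have hN1 : ∀ w ∈ N1, ∑ j, w j • x j = 0 := by
    intro w hw
    induction hw using Submodule.span_induction with
    | mem w hw => obtain ⟨i, rfl⟩ := hw; exact Mt_row c X x h1 i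
    | zero => simp
    | add a b _ _ ha hb => simp [add_smul, Finset.sum_add_distrib, ha, hb]
    | smul r a _ ha => simp [mul_smul, ← Finset.smul_sum, ha]
  have hU : ∀ v ∈ U, ∑ i, (∑ j, c i j * v j) • z i = 0 := fun v hv => h2 v (Mt_ker c X v hv)
  have hrn := LinearMap.finrank_range_add_finrank_ker (PhiM x z)
  rw [Module.finrank_prod, Module.finrank_fin_fun, Module.finrank_fin_fun] at hrn
  let ev : (Fin ℓ → ℂ) →ₗ[ℂ] (Fin n → ℂ) := (Matrix.of c).mulVecLin
  have hev : ∀ v i, ev v i = ∑ j, c i j * v j := fun v i => by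
    simp [ev, Matrix.mulVec, dotProduct]
  let Ψ : ((N1 × U) × ℂ) →ₗ[ℂ] ((Fin ℓ → ℂ) × (Fin n → ℂ)) :=
    ((N1.subtype.comp (LinearMap.fst ℂ N1 U)).comp (LinearMap.fst ℂ _ _)).prod
      (((ev.comp U.subtype).comp ((LinearMap.snd ℂ N1 U).comp (LinearMap.fst ℂ _ _))) +
        (LinearMap.toSpanSingleton ℂ (Fin n → ℂ) (fun i => if i ∈ X then 1 else 0)).comp (LinearMap.snd ℂ _ _))
  have hΨ : ∀ w v s, Ψ ((w, v), s) = (w.1, ev v.1 + s • fun i => if i ∈ X then 1 else 0) := fun w v s => rfl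
  have hmem : ∀ y, Ψ y ∈ LinearMap.ker (PhiM x z) := by
    rintro ⟨⟨w, v⟩, s⟩
    rw [LinearMap.mem_ker, hΨ, PhiM_apply, hN1 _ w.2, zero_add]
    simp only [Pi.add_apply, add_smul, Finset.sum_add_distrib, hev, hU _ v.2, zero_add]
    simp only [Pi.smul_apply, smul_eq_mul, mul_smul, ← Finset.smul_sum]
    simp [h3]
  have hevX : ∀ v ∈ U, ∀ i ∈ X, ev v i = 0 := fun v hv i hi => by
    rw [hev]; exact Mt_ker c X v hv i hi
  have hevinj : ∀ v, ev v = 0 → v = 0 := fun v hv => c_inj c hess v fun i => by rw [← hev, hv]; rfl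
  have e1 : ℓ ≤ Module.finrank ℂ (LinearMap.ker (PhiM x z)) := by
    refine hdim.symm.le.trans ?_
    rw [← Module.finrank_prod]
    let Ψ1 : (N1 × U) →ₗ[ℂ] LinearMap.ker (PhiM x z) :=
      LinearMap.codRestrict _ (Ψ.comp (LinearMap.inl ℂ _ _)) fun y => hmem _
    refine LinearMap.finrank_le_finrank_of_injective (f := Ψ1) ?_
    rw [← LinearMap.ker_eq_bot, LinearMap.ker_eq_bot']
    rintro ⟨w, v⟩ h
    have h := congrArg Subtype.val h
    change Ψ ((w, v), 0) = 0 at h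
    rw [hΨ, zero_smul, add_zero, Prod.mk_eq_zero] at h
    exact Prod.ext (Subtype.ext h.1) (Subtype.ext (hevinj _ h.2))
  refine ⟨by omega, fun ⟨i0, hi0⟩ => ?_⟩
  have e2 : ℓ + 1 ≤ Module.finrank ℂ (LinearMap.ker (PhiM x z)) := by
    have : Module.finrank ℂ ((N1 × U) × ℂ) = ℓ + 1 := by
      rw [Module.finrank_prod, Module.finrank_prod, hdim]; simp
    rw [← this]
    let Ψ1 : ((N1 × U) × ℂ) →ₗ[ℂ] LinearMap.ker (PhiM x z) :=
      LinearMap.codRestrict _ Ψ fun y => hmem _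
    refine LinearMap.finrank_le_finrank_of_injective (f := Ψ1) ?_
    rw [← LinearMap.ker_eq_bot, LinearMap.ker_eq_bot']
    rintro ⟨⟨w, v⟩, s⟩ h
    have h := congrArg Subtype.val h
    change Ψ ((w, v), s) = 0 at h
    rw [hΨ, Prod.mk_eq_zero] at h
    have hs : s = 0 := by
      have := congrFun h.2 i0
      simpa [hevX _ v.2 i0 hi0, hi0] using this
    rw [hs, zero_smul, add_zero] at h
    exact Prod.ext (Prod.ext (Subtype.ext h.1) (Subtype.ext (hevinj _ h.2))) hs
  omega
end LA

lemma trdeg_bound {B K : Type} [CommRing B] [IsDomain B] [Algebra ℂ B] [Field K] [Algebra ℂ K]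
    [Algebra B K] [IsScalarTower ℂ B K] [IsFractionRing B K] (s : Set K)
    (h : ∀ b : B, algebraMap B K b ∈ IntermediateField.adjoin ℂ s) :
    Algebra.trdeg ℂ B ≤ Cardinal.mk s := by
  have halg : Algebra.IsAlgebraic (Algebra.adjoin ℂ s) K := by
    constructor
    intro x
    have hx : x ∈ IntermediateField.adjoin ℂ s := by
      obtain ⟨a, b, _, rfl⟩ := IsFractionRing.div_surjective (A := B) x
      exact div_mem (h a) (h b)
    rw [IntermediateField.mem_adjoin_iff_div] at hx
    obtain ⟨r, hr, t, ht, rfl⟩ := hx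
    rw [div_eq_mul_inv]
    exact (isAlgebraic_algebraMap (A := K) (⟨r, hr⟩ : Algebra.adjoin ℂ s)).mul
      (isAlgebraic_algebraMap (A := K) (⟨t, ht⟩ : Algebra.adjoin ℂ s)).inv
  refine le_trans ?_ (Algebra.IsAlgebraic.trdeg_le_cardinalMk ℂ s)
  exact trdeg_le_of_injective (IsScalarTower.toAlgHom ℂ B K) (IsFractionRing.injective B K)

section reg
variable {ℓ n : ℕ} {c : Fin n → Fin ℓ → ℂ}

lemma euler_mem (h : Good c) : ∑ i, X (Sum.inl i) ∈ Ilog c := by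
  rw [mem_Ilog h]
  have hf : ∀ i, ∑ j, X (Sum.inr j) * C (c i j) = fS c i := fun i =>
    Finset.sum_congr rfl fun j _ => mul_comm _ _
  refine ⟨fun j => X (Sum.inr j), fun i => by rw [hf], ?_⟩
  unfold Qd
  simp only [Finset.mul_sum]
  rw [Finset.sum_comm]
  refine Finset.sum_congr rfl fun i _ => ?_
  rw [← QS_eq c i, ← hf i, Finset.sum_mul, Finset.sum_mul]
  exact Finset.sum_congr rfl fun j _ => by ring

lemma vec_mem (h : Good c) (Y : Finset (Fin n)) (v : Fin ℓ → ℂ) (hv : ∀ i ∉ Y, ∑ j, c i j * v j = 0) :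
    ∑ i ∈ Y, X (Sum.inl i) * C (∑ j, c i j * v j) * ∏ k ∈ Y.erase i, fS c k ∈ Ilog c := by
  classical
  rw [mem_Ilog h]
  have hs : ∀ i, ∑ j, ((∏ k ∈ Y, fS c k) * C (v j)) * C (c i j) = (∏ k ∈ Y, fS c k) * C (∑ j, c i j * v j) := by
    intro i
    rw [map_sum, Finset.mul_sum]
    exact Finset.sum_congr rfl fun j _ => by rw [C_mul]; ring
  refine ⟨fun j => (∏ k ∈ Y, fS c k) * C (v j), fun i => ?_, ?_⟩
  · rw [hs]
    by_cases hi : i ∈ Y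
    · exact (Finset.dvd_prod_of_mem _ hi).mul_right _
    · rw [hv i hi]; simp
  · unfold Qd
    simp only [Finset.mul_sum]
    rw [Finset.sum_comm]
    have : ∀ i, ∑ j, (∏ k ∈ Y, fS c k) * C (v j) * (X (Sum.inl i) * C (c i j) * Qdiv c i) =
        (X (Sum.inl i) * Qdiv c i) * ((∏ k ∈ Y, fS c k) * C (∑ j, c i j * v j)) := by
      intro i
      rw [← hs, Finset.mul_sum]
      exact Finset.sum_congr rfl fun j _ => by ring
    simp only [this]
    rw [← Finset.sum_subset (Finset.subset_univ Y)]
    · refine Finset.sum_congr rfl fun i hi => ?_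
      rw [← QS_eq c i, ← Finset.mul_prod_erase _ _ hi]
      ring
    · intro i _ hi
      rw [hv i hi]; simp

lemma trdeg_le (h : Good c) (hess : Submodule.span ℂ (Set.range c) = ⊤) (P : Ideal (SS n ℓ)) (hP : P.IsPrime)
    (hI : Ilog c ≤ P) : ∃ d : ℕ, Algebra.trdeg ℂ (SS n ℓ ⧸ P) ≤ (d : Cardinal) ∧ d ≤ n ∧ (QS c ∈ P → d + 1 ≤ n) := by
  classical
  let K := FractionRing (SS n ℓ ⧸ P)
  let φ : SS n ℓ →ₐ[ℂ] K := (IsScalarTower.toAlgHom ℂ (SS n ℓ ⧸ P) K).comp (Ideal.Quotient.mkₐ ℂ P)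
  have hφ : ∀ g, φ g = 0 ↔ g ∈ P := by
    intro g
    show algebraMap (SS n ℓ ⧸ P) K (Ideal.Quotient.mk P g) = 0 ↔ _
    rw [FaithfulSMul.algebraMap_eq_zero_iff, Ideal.Quotient.eq_zero_iff_mem]
  let Y : Finset (Fin n) := univ.filter fun i => fS c i ∉ P
  have hY : ∀ i, i ∈ Y ↔ φ (fS c i) ≠ 0 := fun i => by simp [Y, hφ]
  let x : Fin ℓ → K := fun j => φ (X (Sum.inr j))
  let z : Fin n → K := fun i => if i ∈ Y then φ (X (Sum.inl i)) / φ (fS c i) else φ (X (Sum.inl i))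
  have hfx : ∀ i, ∑ j, c i j • x j = φ (fS c i) := by
    intro i
    unfold fS
    rw [map_sum]
    refine Finset.sum_congr rfl fun j _ => ?_
    rw [map_mul, ← algebraMap_eq, AlgHom.commutes, Algebra.smul_def]
  have h1 : ∀ i ∈ Yᶜ, ∑ j, c i j • x j = 0 := by
    intro i hi
    rw [hfx]
    by_contra h0
    exact (Finset.mem_compl.1 hi) ((hY i).2 h0)
  have hzY : ∀ i ∈ Y, φ (X (Sum.inl i)) = z i * φ (fS c i) := by
    intro i hi
    simp only [z, if_pos hi]
    rw [div_mul_cancel₀ _ ((hY i).1 hi)]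
  have h2 : ∀ v : Fin ℓ → ℂ, (∀ i ∈ Yᶜ, ∑ j, c i j * v j = 0) → ∑ i, (∑ j, c i j * v j) • z i = 0 := by
    intro v hv
    have hv' : ∀ i ∉ Y, ∑ j, c i j * v j = 0 := fun i hi => hv i (Finset.mem_compl.2 hi)
    have e := (hφ _).2 (hI (vec_mem h Y v hv'))
    rw [← Finset.sum_subset (Finset.subset_univ Y) (fun i _ hi => by rw [hv' i hi, zero_smul])]
    have hne : φ (∏ k ∈ Y, fS c k) ≠ 0 := by
      rw [map_prod]
      exact Finset.prod_ne_zero_iff.2 fun i hi => (hY i).1 hi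
    apply mul_left_cancel₀ hne
    rw [mul_zero, ← e, map_sum, Finset.mul_sum]
    refine Finset.sum_congr rfl fun i hi => ?_
    rw [map_mul, map_mul, hzY i hi, ← Finset.mul_prod_erase _ _ hi, map_mul, ← algebraMap_eq, AlgHom.commutes,
      Algebra.smul_def]
    ring
  have h3 : ∑ i ∈ Yᶜ, z i = 0 := by
    have e0 := LA0 c Yᶜ x z h1 h2
    have e1 := (hφ _).2 (hI (euler_mem h))
    rw [map_sum, ← Finset.sum_add_sum_compl Y] at e1
    rw [← Finset.sum_add_sum_compl Y, Finset.sum_eq_zero (s := Yᶜ) (fun i hi => by rw [h1 i hi, mul_zero]), add_zero] at e0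
    have e2 : ∑ i ∈ Y, φ (X (Sum.inl i)) = 0 := by
      rw [← e0]
      exact Finset.sum_congr rfl fun i hi => by rw [hzY i hi, hfx]
    rw [e2, zero_add] at e1
    rw [← e1]
    refine Finset.sum_congr rfl fun i hi => ?_
    simp only [z, if_neg (Finset.mem_compl.1 hi)]
  obtain ⟨l1, l2⟩ := LA1 c hess Yᶜ x z h1 h2 h3
  let V := LinearMap.range (PhiM x z)
  let b := Module.finBasis ℂ V
  let s : Set K := Set.range fun i => (b i : K)
  refine ⟨Module.finrank ℂ V, ?_, l1, fun hQ => l2 ?_⟩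
  · have hs : Cardinal.mk s ≤ (Module.finrank ℂ V : Cardinal) := by
      refine Cardinal.mk_range_le.trans ?_
      simp
    refine le_trans (trdeg_bound (K := K) s ?_) hs
    have hV : ∀ y ∈ V, y ∈ IntermediateField.adjoin ℂ s := by
      intro y hy
      have := b.sum_repr ⟨y, hy⟩
      have := congrArg Subtype.val this
      simp only [Submodule.coe_sum, Submodule.coe_smul] at this
      rw [← this]
      refine sum_mem fun i _ => ?_
      refine (IntermediateField.adjoin ℂ s).smul_mem (IntermediateField.subset_adjoin ℂ s ⟨i, rfl⟩)
    have hx : ∀ j, x j ∈ IntermediateField.adjoin ℂ s := fun j => hV _ ⟨(Pi.single j 1, 0), by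
      rw [PhiM_apply]; simp [Pi.single_apply]⟩
    have hz : ∀ i, z i ∈ IntermediateField.adjoin ℂ s := fun i => hV _ ⟨(0, Pi.single i 1), by
      rw [PhiM_apply]; simp [Pi.single_apply]⟩
    intro y
    obtain ⟨g, rfl⟩ := Ideal.Quotient.mk_surjective y
    show φ g ∈ _
    induction g using MvPolynomial.induction_on with
    | C a => rw [← algebraMap_eq, AlgHom.commutes]; exact (IntermediateField.adjoin ℂ s).algebraMap_mem a
    | add p q hp hq => rw [map_add]; exact add_mem hp hq
    | mul_X p i hp =>
      rw [map_mul]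
      refine mul_mem hp ?_
      rcases i with i | j
      · by_cases hi : i ∈ Y
        · rw [hzY i hi, ← hfx]
          exact mul_mem (hz i) (sum_mem fun j _ => (IntermediateField.adjoin ℂ s).smul_mem (hx j))
        · have : φ (X (Sum.inl i)) = z i := by simp only [z, if_neg hi]
          rw [this]; exact hz i
      · exact hx j
  · obtain ⟨i, _, hi⟩ := (hP.prod_mem_iff).1 hQ
    exact ⟨i, Finset.mem_compl.2 fun h => (hY i).1 h ((hφ _).2 hi)⟩

lemma regB (h : Good c) (hess : Submodule.span ℂ (Set.range c) = ⊤) : RegB c := by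
  intro P hP hI
  obtain ⟨d, h1, h2, h3⟩ := trdeg_le h hess P hP hI
  obtain ⟨rs, r1, r2, r3⟩ := exists_reg_seq P hP d h1
  rw [Fintype.card_sum, Fintype.card_fin, Fintype.card_fin] at r3
  exact ⟨rs, r1, r2, by omega, fun hQ => by have := h3 hQ; omega⟩
end reg

section fin
variable {ℓ n : ℕ} {c : Fin n → Fin ℓ → ℂ}

lemma exists_s (hess : Submodule.span ℂ (Set.range c) = ⊤) :
    ∃ s : Fin n → Fin ℓ → ℂ, ∀ j j', ∑ i, s i j * c i j' = if j = j' then 1 else 0 := by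
  have : ∀ j : Fin ℓ, ∃ t : Fin n → ℂ, ∑ i, t i • c i = Pi.single j 1 := fun j => by
    rw [← Submodule.mem_span_range_iff_exists_fun, hess]; trivial
  choose t ht using this
  refine ⟨fun i j => t j i, fun j j' => ?_⟩
  have := congrFun (ht j) j'
  simpa [Finset.sum_apply, Pi.single_apply, eq_comm] using this

/-- projection matrix -/
noncomputable def pm (c s : Fin n → Fin ℓ → ℂ) (i k : Fin n) : ℂ := (if i = k then 1 else 0) - ∑ j, s i j * c k j

lemma pm_c (s : Fin n → Fin ℓ → ℂ) (hs : ∀ j j', ∑ i, s i j * c i j' = if j = j' then 1 else 0) (k j') :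
    ∑ i, pm c s i k * c i j' = 0 := by
  have : ∑ i, (∑ j, s i j * c k j) * c i j' = c k j' := by
    simp only [Finset.sum_mul]
    rw [Finset.sum_comm]
    have : ∀ j, ∑ i, s i j * c k j * c i j' = c k j * (if j = j' then 1 else 0) := fun j => by
      rw [← hs, Finset.mul_sum]
      exact Finset.sum_congr rfl fun i _ => by ring
    simp [this]
  simp [pm, sub_mul, this]

/-- generic sum manipulation -/
lemma pm_sum {A : Type*} [CommRing A] (f : ℂ →+* A) (s : Fin n → Fin ℓ → ℂ) (t : Fin n → A)
    (ht : ∀ j, ∑ k, t k * f (c k j) = 0) (i : Fin n) : ∑ k, f (pm c s i k) * t k = t i := by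
  have : ∑ k, f (∑ j, s i j * c k j) * t k = 0 := by
    simp only [map_sum, map_mul, Finset.sum_mul]
    rw [Finset.sum_comm]
    refine Finset.sum_eq_zero fun j _ => ?_
    rw [← mul_zero (f (s i j)), ← ht j, Finset.mul_sum]
    exact Finset.sum_congr rfl fun k _ => by ring
  simp only [pm, map_sub, sub_mul, Finset.sum_sub_distrib, this]
  simp

lemma pm_sum' {A : Type*} [CommRing A] (f : ℂ →+* A) (s : Fin n → Fin ℓ → ℂ)
    (hs : ∀ j j', ∑ i, s i j * c i j' = if j = j' then 1 else 0) (t : Fin n → A) (j : Fin ℓ) :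
    ∑ i, (∑ k, f (pm c s i k) * t k) * f (c i j) = 0 := by
  simp only [Finset.sum_mul]
  rw [Finset.sum_comm]
  refine Finset.sum_eq_zero fun k _ => ?_
  have := congrArg (fun u => f u * t k) (pm_c s hs k j)
  simp only [map_sum, map_mul, map_zero, zero_mul, Finset.sum_mul] at this
  rw [← this]
  exact Finset.sum_congr rfl fun i _ => by ring

/-- substitution values -/
noncomputable def phv (c s : Fin n → Fin ℓ → ℂ) : Fin n ⊕ Fin ℓ → SS n ℓ :=
  Sum.elim (fun i => fS c i * ∑ k, C (pm c s i k) * X (Sum.inl k)) (fun j => X (Sum.inr j))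

/-- substitution -/
noncomputable def phm (c s : Fin n → Fin ℓ → ℂ) : SS n ℓ →+* SS n ℓ := eval₂Hom C (phv c s)

lemma phm_C (s : Fin n → Fin ℓ → ℂ) (a) : phm c s (C a) = C a := by simp [phm]
lemma phm_X (s : Fin n → Fin ℓ → ℂ) (a) : phm c s (X a) = phv c s a := by simp [phm]
lemma phm_f (s : Fin n → Fin ℓ → ℂ) (i) : phm c s (fS c i) = fS c i := by
  unfold fS
  simp only [map_sum, map_mul, phm_C, phm_X]; rfl
lemma phm_Q (s : Fin n → Fin ℓ → ℂ) : phm c s (QS c) = QS c := by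
  simp only [QS, map_prod, phm_f]
lemma phm_Qd (s : Fin n → Fin ℓ → ℂ) (i) : phm c s (Qdiv c i) = Qdiv c i := by
  simp only [Qdiv, map_prod, phm_f]

lemma Ilog_le_ker (h : Good c) (s : Fin n → Fin ℓ → ℂ)
    (hs : ∀ j j', ∑ i, s i j * c i j' = if j = j' then 1 else 0) : Ilog c ≤ RingHom.ker (phm c s) := by
  intro g hg
  obtain ⟨θ, _, h2⟩ := (mem_Ilog h g).1 hg
  have h3 : ∀ j, phm c s (Qd c j) = 0 := by
    intro j
    have := pm_sum' (C : ℂ →+* SS n ℓ) s hs (fun k => X (Sum.inl k)) j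
    rw [← mul_zero (QS c), ← this, Finset.mul_sum, Qd, map_sum]
    refine Finset.sum_congr rfl fun i _ => ?_
    rw [map_mul, map_mul, phm_C, phm_X, phm_Qd, ← QS_eq c i]
    simp only [phv, Sum.elim_inl]
    ring
  have := congrArg (phm c s) h2
  rw [map_mul, phm_Q, map_sum, Finset.sum_eq_zero (fun j _ => by rw [map_mul, h3, mul_zero])] at this
  exact (mul_eq_zero.1 this).resolve_left h.Q0

lemma Qd_mem (h : Good c) (j : Fin ℓ) : Qd c j ∈ Ilog c := by
  classical
  rw [mem_Ilog h]
  refine ⟨Pi.single j (QS c), fun i => ?_, ?_⟩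
  · refine Finset.dvd_sum fun k _ => Dvd.dvd.mul_right ?_ _
    by_cases hk : k = j
    · subst hk; rw [Pi.single_eq_same]; exact Finset.dvd_prod_of_mem _ (mem_univ i)
    · rw [Pi.single_eq_of_ne hk]; exact dvd_zero _
  · simp [Pi.single_apply]

lemma ker_pow (h : Good c) (s : Fin n → Fin ℓ → ℂ)
    (g : SS n ℓ) (hg : phm c s g = 0) : ∃ N : ℕ, QS c ^ N * g ∈ Ilog c := by
  let L := Localization.Away (QS c)
  let J : Ideal L := (Ilog c).map (algebraMap (SS n ℓ) L)
  let α : SS n ℓ →+* (L ⧸ J) := (Ideal.Quotient.mk J).comp (algebraMap (SS n ℓ) L)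
  have hQu : IsUnit (α (QS c)) := (IsLocalization.Away.algebraMap_isUnit (S := L) (QS c)).map (Ideal.Quotient.mk J)
  have hαQ : ∀ i, α (QS c) = α (fS c i) * α (Qdiv c i) := fun i => by
    rw [← map_mul]; exact congrArg α (QS_eq c i).symm
  have hfu : ∀ i, IsUnit (α (fS c i)) := fun i => by
    rw [hαQ i] at hQu
    exact isUnit_of_mul_isUnit_left hQu
  choose v hv using fun i => (hfu i).exists_right_inv
  have hα : ∀ g ∈ Ilog c, α g = 0 := fun g hg =>
    Ideal.Quotient.eq_zero_iff_mem.2 (Ideal.mem_map_of_mem _ hg)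
  let t : Fin n → L ⧸ J := fun i => α (X (Sum.inl i)) * v i
  let ψ : SS n ℓ →+* (L ⧸ J) := eval₂Hom (α.comp C) (Sum.elim t fun j => α (X (Sum.inr j)))
  have hψC : ∀ a, ψ (C a) = α (C a) := fun a => by simp [ψ]
  have hψl : ∀ i, ψ (X (Sum.inl i)) = t i := fun a => by simp [ψ]
  have hψr : ∀ i, ψ (X (Sum.inr i)) = α (X (Sum.inr i)) := fun a => by simp [ψ]
  have hψf : ∀ i, ψ (fS c i) = α (fS c i) := fun i => by
    unfold fS
    simp only [map_sum, map_mul, hψC, hψr]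
  have ht : ∀ j, ∑ k, t k * (α.comp C) (c k j) = 0 := by
    intro j
    apply hQu.mul_left_cancel
    rw [mul_zero, ← hα _ (Qd_mem h j), Qd, map_sum, Finset.mul_sum]
    refine Finset.sum_congr rfl fun k _ => ?_
    rw [hαQ k]
    simp only [t, map_mul, RingHom.comp_apply]
    linear_combination (α (Qdiv c k) * α (X (Sum.inl k)) * α (C (c k j))) * hv k
  have hαβ : ψ.comp (phm c s) = α := by
    apply MvPolynomial.ringHom_ext
    · intro a
      rw [RingHom.comp_apply, phm_C, hψC]
    · rintro (i | j)
      · rw [RingHom.comp_apply, phm_X]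
        simp only [phv, Sum.elim_inl, map_mul, map_sum, hψf, hψC, hψl]
        have := pm_sum (α.comp C) s t ht i
        simp only [RingHom.comp_apply] at this
        rw [this]
        linear_combination α (X (Sum.inl i)) * hv i
      · rw [RingHom.comp_apply, phm_X]
        simp only [phv, Sum.elim_inr, hψr]
  have h0 : α g = 0 := by rw [← hαβ, RingHom.comp_apply, hg, map_zero]
  have h1 : algebraMap (SS n ℓ) L g ∈ J := Ideal.Quotient.eq_zero_iff_mem.1 h0
  rw [IsLocalization.mem_map_algebraMap_iff (Submonoid.powers (QS c))] at h1
  obtain ⟨⟨a, ⟨_, N, rfl⟩⟩, h2⟩ := h1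
  refine ⟨N, ?_⟩
  simp only [← map_mul] at h2
  have hinj : Function.Injective (algebraMap (SS n ℓ) L) :=
    IsLocalization.injective L (powers_le_nonZeroDivisors_of_noZeroDivisors h.Q0)
  have h3 := hinj h2
  rw [mul_comm, h3]
  exact a.2

lemma Q_pow_sat (h : Good c) (htame : ArrTame c) (hR : RegB c) (g : SS n ℓ) (N : ℕ)
    (hg : QS c ^ N * g ∈ Ilog c) : g ∈ Ilog c := by
  induction N with
  | zero => simpa using hg
  | succ N ih => exact ih (Q_sat h htame hR _ (by rwa [pow_succ', mul_assoc] at hg))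

lemma eval_phm (s : Fin n → Fin ℓ → ℂ) (t : Fin n → ℂ) (x : Fin ℓ → ℂ) (g : SS n ℓ) :
    eval (Sum.elim t x) (phm c s g) =
      eval (Sum.elim (fun i => (∑ j, c i j * x j) * ∑ k, pm c s i k * t k) x) g := by
  have : (eval (Sum.elim t x)).comp (phm c s) =
      eval (Sum.elim (fun i => (∑ j, c i j * x j) * ∑ k, pm c s i k * t k) x) := by
    apply MvPolynomial.ringHom_ext
    · intro a; rw [RingHom.comp_apply, phm_C]; simp
    · rintro (i | j)
      · rw [RingHom.comp_apply, phm_X]; simp [phv, fS]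
      · rw [RingHom.comp_apply, phm_X]; simp [phv]
  rw [← this]; rfl

lemma ker_iff (h : Good c) (s : Fin n → Fin ℓ → ℂ)
    (hs : ∀ j j', ∑ i, s i j * c i j' = if j = j' then 1 else 0) (g : SS n ℓ) :
    phm c s g = 0 ↔ ∀ (x : Fin ℓ → ℂ) (lam : Fin n → ℂ),
          (∀ i, (∑ j, c i j * x j) ≠ 0) →
          (∀ j, (∑ i, lam i * c i j / (∑ j', c i j' * x j')) = 0) →
          eval (Sum.elim lam x) g = 0 := by
  constructor
  · intro hg x lam hx hl
    have h1 := eval_phm (c := c) s (fun i => lam i / ∑ j, c i j * x j) x g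
    rw [hg, map_zero] at h1
    rw [h1]
    congr 2
    have h2 := pm_sum (c := c) (RingHom.id ℂ) s (fun i => lam i / ∑ j, c i j * x j) (fun j => by
      rw [← hl j]
      exact Finset.sum_congr rfl fun i _ => by simp only [RingHom.id_apply]; ring)
    simp only [RingHom.id_apply] at h2
    congr 1
    funext i
    rw [h2, mul_div_cancel₀ _ (hx i)]
  · intro hg
    have : QS c * phm c s g = 0 := by
      apply MvPolynomial.funext
      intro y
      have hy : y = Sum.elim (y ∘ Sum.inl) (y ∘ Sum.inr) := (Sum.elim_comp_inl_inr y).symm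
      set t := y ∘ Sum.inl
      set x := y ∘ Sum.inr
      rw [hy, map_mul, map_zero]
      by_cases hx : ∀ i, (∑ j, c i j * x j) ≠ 0
      · rw [eval_phm, hg x _ hx, mul_zero]
        intro j
        have := pm_sum' (c := c) (RingHom.id ℂ) s hs t j
        simp only [RingHom.id_apply] at this
        rw [← this]
        refine Finset.sum_congr rfl fun i _ => ?_
        rw [mul_assoc, mul_div_cancel_left₀ _ (hx i)]
      · push Not at hx
        obtain ⟨i, hi⟩ := hx
        have : eval (Sum.elim t x) (QS c) = 0 := by
          rw [QS, map_prod]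
          refine Finset.prod_eq_zero (mem_univ i) ?_
          simpa [fS] using hi
        rw [this, zero_mul]
    exact (mul_eq_zero.1 this).resolve_left h.Q0
end fin

theorem tame_logarithmic_ideal_prime_and_vanishing
    (ℓ n : ℕ) (c : Fin n → Fin ℓ → ℂ)
    (hnz : ∀ i, c i ≠ 0)
    (hprop : ∀ i k, i ≠ k → ∀ t : ℂ, c i ≠ t • c k)
    (hess : Submodule.span ℂ (Set.range c) = ⊤)
    (htame : ArrTame c) :
    (Ilog c).IsPrime ∧
    ∀ g : MvPolynomial (Fin n ⊕ Fin ℓ) ℂ,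
      g ∈ Ilog c ↔
        ∀ (x : Fin ℓ → ℂ) (lam : Fin n → ℂ),
          (∀ i, (∑ j, c i j * x j) ≠ 0) →
          (∀ j, (∑ i, lam i * c i j / (∑ j', c i j' * x j')) = 0) →
          eval (Sum.elim lam x) g = 0 := by
  have h : Good c := ⟨hnz, hprop⟩
  obtain ⟨s, hs⟩ := exists_s hess
  have hI : Ilog c = RingHom.ker (phm c s) := by
    apply le_antisymm (Ilog_le_ker h s hs)
    intro g hg
    obtain ⟨N, hN⟩ := ker_pow h s g hg
    exact Q_pow_sat h htame (regB h hess) g N hN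
  refine ⟨?_, fun g => ?_⟩
  · rw [hI]; exact RingHom.ker_isPrime _
  · rw [hI, RingHom.mem_ker]; exact ker_iff h s hs g
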